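/- Let μ be a finite positive Borel measure on the open unit disc 𝔻. Then there exists an outer function E belonging to QA, whose boundary function log|E| belongs to BMO, such that the measure |E|μ (given by d(|E|μ)(z) = |E(z)| dμ(z)) is a vanishing Carleson measure. -/

import Mathlib

open MeasureTheory Filter Set Topology

noncomputable section

/-- The open unit disc in `ℂ`. -/
def unitDisc : Set ℂ := {z : ℂ | ‖z‖ < 1}

/-- The point `e^{iθ}` on the unit circle. -/
def circlePt (θ : ℝ) : ℂ := Complex.exp ((θ : ℂ) * Complex.I)

/-- The Carleson square based on the arc centered at `e^{iθ₀}` of normalized length `t`. -/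
def carlesonSquare (θ₀ t : ℝ) : Set ℂ :=
  {z : ℂ | z ∈ unitDisc ∧ 1 - t ≤ ‖z‖ ∧
    ∃ θ : ℝ, |θ - θ₀| ≤ Real.pi * t ∧ z = (‖z‖ : ℂ) * circlePt θ}

/-- `μ` is a Carleson measure. -/
def IsCarleson (μ : Measure ℂ) : Prop :=
  ∃ C : ℝ, 0 < C ∧ ∀ θ₀ t : ℝ, 0 < t → t ≤ 1 →
    μ (carlesonSquare θ₀ t) ≤ ENNReal.ofReal (C * t)

/-- `μ` is a vanishing Carleson measure. -/
def IsVanishingCarleson (μ : Measure ℂ) : Prop :=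
  IsCarleson μ ∧ ∀ ε : ℝ, 0 < ε → ∃ δ : ℝ, 0 < δ ∧ ∀ θ₀ t : ℝ, 0 < t → t < δ →
    μ (carlesonSquare θ₀ t) ≤ ENNReal.ofReal (ε * t)

/-- The measure `|E| μ`, i.e. `d(|E|μ)(z) = |E(z)| dμ(z)`. -/
def absDensity (E : ℂ → ℂ) (μ : Measure ℂ) : Measure ℂ :=
  μ.withDensity (fun z => ENNReal.ofReal ‖E z‖)

/-- Average of a boundary function (in the angle variable) over the arc
centered at `e^{iθ₀}` of normalized length `t`; `dm = dθ/(2π)`. -/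
def arcAvg (f : ℝ → ℂ) (θ₀ t : ℝ) : ℂ :=
  ((2 * Real.pi * t)⁻¹ : ℝ) •
    ∫ θ in Set.Ioo (θ₀ - Real.pi * t) (θ₀ + Real.pi * t), f θ

/-- Mean oscillation of a boundary function over the arc centered at `e^{iθ₀}`
of normalized length `t`. -/
def meanOsc (f : ℝ → ℂ) (θ₀ t : ℝ) : ℝ :=
  (2 * Real.pi * t)⁻¹ *
    ∫ θ in Set.Ioo (θ₀ - Real.pi * t) (θ₀ + Real.pi * t), ‖f θ - arcAvg f θ₀ t‖

/-- A (2π-periodic, integrable) boundary function has bounded mean oscillation. -/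
def IsBMO (f : ℝ → ℂ) : Prop :=
  (∀ θ : ℝ, f (θ + 2 * Real.pi) = f θ) ∧
  IntegrableOn f (Set.Ioc 0 (2 * Real.pi)) ∧
  ∃ C : ℝ, ∀ θ₀ t : ℝ, 0 < t → t ≤ 1 → meanOsc f θ₀ t ≤ C

/-- A boundary function has vanishing mean oscillation. -/
def IsVMO (f : ℝ → ℂ) : Prop :=
  IsBMO f ∧ ∀ ε : ℝ, 0 < ε → ∃ δ : ℝ, 0 < δ ∧
    ∀ θ₀ t : ℝ, 0 < t → t < δ → meanOsc f θ₀ t ≤ ε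

/-- The BMO seminorm of a boundary function. -/
def bmoSeminorm (f : ℝ → ℂ) : ℝ :=
  sSup {c : ℝ | ∃ θ₀ t : ℝ, 0 < t ∧ t ≤ 1 ∧ c = meanOsc f θ₀ t}

/-- `Fb` is the (a.e.) radial boundary function of `F`. -/
def HasRadialLimits (F : ℂ → ℂ) (Fb : ℝ → ℂ) : Prop :=
  ∀ᵐ θ ∂(volume.restrict (Set.Ioc 0 (2 * Real.pi))),
    Tendsto (fun r : ℝ => F ((r : ℂ) * circlePt θ))
      (nhdsWithin 1 (Set.Iio 1)) (nhds (Fb θ))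

/-- `F` is a bounded analytic function on the unit disc. -/
def MemHinf (F : ℂ → ℂ) : Prop :=
  DifferentiableOn ℂ F unitDisc ∧ ∃ M : ℝ, ∀ z ∈ unitDisc, ‖F z‖ ≤ M

/-- `F` belongs to `QA` with boundary function `Fb`: it is a bounded analytic
function on the disc whose radial boundary values are in VMO. -/
def MemQA (F : ℂ → ℂ) (Fb : ℝ → ℂ) : Prop :=
  MemHinf F ∧ HasRadialLimits F Fb ∧ IsVMO Fb

/-- `E` is an outer function. -/
def IsOuter (E : ℂ → ℂ) : Prop :=
  DifferentiableOn ℂ E unitDisc ∧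
  ∃ h : ℝ → ℝ, IntegrableOn h (Set.Ioc 0 (2 * Real.pi)) ∧ ∀ z ∈ unitDisc,
    E z = Complex.exp (((2 * Real.pi)⁻¹ : ℝ) • ∫ θ in Set.Ioc 0 (2 * Real.pi),
      ((circlePt θ + z) / (circlePt θ - z)) * (h θ : ℂ))

/-- The integral means appearing in the definition of the Hardy space `ℍ^p`. -/
def hardyIntegral (p : ℝ) (F : ℂ → ℂ) (r : ℝ) : ℝ :=
  ∫ θ in Set.Ioc 0 (2 * Real.pi), ‖F ((r : ℂ) * circlePt θ)‖ ^ p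

/-- `F` belongs to the Hardy space `ℍ^p`, `0 < p < ∞`. -/
def MemHardy (p : ℝ) (F : ℂ → ℂ) : Prop :=
  DifferentiableOn ℂ F unitDisc ∧
  ∃ M : ℝ, ∀ r : ℝ, 0 < r → r < 1 → hardyIntegral p F r ≤ M

/-- `F` belongs to `BMOA` with boundary function `Fb`. -/
def MemBMOA (F : ℂ → ℂ) (Fb : ℝ → ℂ) : Prop :=
  MemHardy 2 F ∧ HasRadialLimits F Fb ∧ IsBMO Fb

/-- `F` belongs to `VMOA` with boundary function `Fb`. -/
def MemVMOA (F : ℂ → ℂ) (Fb : ℝ → ℂ) : Prop :=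
  MemHardy 2 F ∧ HasRadialLimits F Fb ∧ IsVMO Fb

/-- The generalized Volterra operator `T_G(F)(z) = ∫₀^z F(w) G'(w) dw`. -/
def volterra (G F : ℂ → ℂ) (z : ℂ) : ℂ :=
  ∫ t in (0:ℝ)..1, z * F ((t : ℂ) * z) * deriv G ((t : ℂ) * z)

lemma circlePt_eq_circleMap (θ : ℝ) : circlePt θ = circleMap 0 1 θ := by
  simp [circlePt, circleMap]

lemma norm_circlePt (θ : ℝ) : ‖circlePt θ‖ = 1 := by
  simp [circlePt, Complex.norm_exp_ofReal_mul_I]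

lemma circlePt_mem_closedBall (θ : ℝ) : circlePt θ ∈ Metric.closedBall (0 : ℂ) 1 := by
  simp [norm_circlePt]

lemma circlePt_periodic : Function.Periodic circlePt (2 * Real.pi) := by
  intro θ
  rw [circlePt_eq_circleMap, circlePt_eq_circleMap, periodic_circleMap]

lemma continuous_circlePt : Continuous circlePt := by
  unfold circlePt; fun_prop

lemma norm_circlePt_sub_le (θ φ : ℝ) : ‖circlePt θ - circlePt φ‖ ≤ |θ - φ| := by
  have h : circlePt θ - circlePt φ =
      circlePt φ * (Complex.exp (Complex.I * ((θ - φ : ℝ) : ℂ)) - 1) := by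
    rw [mul_sub, mul_one]
    congr 1
    rw [circlePt, circlePt, ← Complex.exp_add]
    congr 1
    push_cast; ring
  rw [h, norm_mul, norm_circlePt, one_mul]
  simpa using Real.norm_exp_I_mul_ofReal_sub_one_le (x := θ - φ)

lemma circlePt_sub_ne_zero {a : ℂ} (ha : ‖a‖ < 1) (θ : ℝ) : circlePt θ - a ≠ 0 := by
  intro h
  rw [sub_eq_zero] at h
  rw [← h, norm_circlePt] at ha
  exact lt_irrefl _ ha

lemma one_sub_norm_le_norm_circlePt_sub (a : ℂ) (θ : ℝ) : 1 - ‖a‖ ≤ ‖circlePt θ - a‖ := by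
  have := norm_sub_norm_le (circlePt θ) a
  rwa [norm_circlePt] at this

lemma circleAverage_eq_setIntegral {V : Type*} [NormedAddCommGroup V] [NormedSpace ℝ V]
    (φ : ℂ → V) :
    Real.circleAverage φ 0 1 =
      (2 * Real.pi)⁻¹ • ∫ θ in Set.Ioc 0 (2 * Real.pi), φ (circlePt θ) := by
  rw [Real.circleAverage_def, intervalIntegral.integral_of_le Real.two_pi_pos.le]
  simp_rw [circlePt_eq_circleMap]

lemma setIntegral_eq_circleAverage {V : Type*} [NormedAddCommGroup V] [NormedSpace ℝ V]
    (φ : ℂ → V) :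
    ∫ θ in Set.Ioc 0 (2 * Real.pi), φ (circlePt θ) = (2 * Real.pi) • Real.circleAverage φ 0 1 := by
  rw [circleAverage_eq_setIntegral, smul_smul, mul_inv_cancel₀ Real.two_pi_pos.ne', one_smul]

/-- The Poisson kernel of the unit disc at `a`, as a function of the angle. -/
def diskPoisson (a : ℂ) (θ : ℝ) : ℝ := (1 - ‖a‖ ^ 2) / ‖circlePt θ - a‖ ^ 2

lemma diskPoisson_nonneg {a : ℂ} (ha : ‖a‖ < 1) (θ : ℝ) : 0 ≤ diskPoisson a θ := by
  have : ‖a‖ ^ 2 ≤ 1 := by nlinarith [norm_nonneg a]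
  exact div_nonneg (by linarith) (by positivity)

lemma diskPoisson_periodic (a : ℂ) : Function.Periodic (diskPoisson a) (2 * Real.pi) := by
  intro θ
  simp only [diskPoisson, circlePt_periodic θ]

lemma continuous_diskPoisson {a : ℂ} (ha : ‖a‖ < 1) : Continuous (diskPoisson a) := by
  unfold diskPoisson
  refine Continuous.div (by fun_prop) ?_ ?_
  · have := continuous_circlePt
    fun_prop
  · intro θ
    have := circlePt_sub_ne_zero ha θ
    positivity

lemma diskPoisson_le {a : ℂ} (ha : ‖a‖ < 1) (θ : ℝ) :
    diskPoisson a θ ≤ 2 / (1 - ‖a‖) := by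
  have h := one_sub_norm_le_norm_circlePt_sub a θ
  have h0 : 0 < 1 - ‖a‖ := by linarith
  have h1 : 0 < ‖circlePt θ - a‖ := by linarith
  unfold diskPoisson
  rw [div_le_div_iff₀ (by positivity) h0]
  nlinarith [norm_nonneg a, mul_self_le_mul_self h0.le h]

lemma setIntegral_diskPoisson_smul {f : ℂ → ℂ} (hf : DiffContOnCl ℂ f (Metric.ball 0 1)) {a : ℂ}
    (ha : ‖a‖ < 1) :
    ∫ θ in Set.Ioc 0 (2 * Real.pi), (diskPoisson a θ : ℂ) * f (circlePt θ) =
      (2 * Real.pi : ℝ) * f a := by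
  have h := hf.circleAverage_poissonKernel_smul (w := a) (by simpa using ha)
  rw [circleAverage_eq_setIntegral] at h
  rw [← h, Complex.real_smul, ← mul_assoc, ← Complex.ofReal_mul,
    mul_inv_cancel₀ Real.two_pi_pos.ne', Complex.ofReal_one, one_mul]
  refine integral_congr_ae (Eventually.of_forall fun θ => ?_)
  simp [diskPoisson, poissonKernel_def, norm_circlePt]

lemma DiffContOnCl.continuousOn_unitClosedBall {f : ℂ → ℂ}
    (hf : DiffContOnCl ℂ f (Metric.ball 0 1)) : ContinuousOn f (Metric.closedBall 0 1) := by
  have := hf.continuousOn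
  rwa [closure_ball _ one_ne_zero] at this

lemma DiffContOnCl.to_abs_one {f : ℂ → ℂ} (hf : DiffContOnCl ℂ f (Metric.ball 0 1)) :
    DiffContOnCl ℂ f (Metric.ball 0 |(1 : ℝ)|) := by
  rwa [abs_one]

/-- The Schwarz integral formula. -/
lemma eq_setIntegral_herglotz_re {f : ℂ → ℂ} (hf : DiffContOnCl ℂ f (Metric.ball 0 1))
    (h0 : (f 0).im = 0) {z : ℂ} (hz : ‖z‖ < 1) :
    f z = ((2 * Real.pi)⁻¹ : ℝ) • ∫ θ in Set.Ioc 0 (2 * Real.pi),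
      ((circlePt θ + z) / (circlePt θ - z)) * ((f (circlePt θ)).re : ℂ) := by
  have hfc := hf.continuousOn_unitClosedBall.comp_continuous continuous_circlePt
    circlePt_mem_closedBall
  have hk : Continuous fun θ => (circlePt θ + z) / (circlePt θ - z) := by
    have := continuous_circlePt
    exact Continuous.div (by fun_prop) (by fun_prop) (circlePt_sub_ne_zero hz)
  -- the analytic half
  have h1 : ∫ θ in Set.Ioc 0 (2 * Real.pi),
      ((circlePt θ + z) / (circlePt θ - z)) * f (circlePt θ) =
      (2 * Real.pi : ℝ) * (2 * f z - f 0) := by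
    have e1 := hf.to_abs_one.circleAverage_smul_div
      (w := z) (by simpa using hz)
    have e2 := hf.to_abs_one.circleAverage
    rw [circleAverage_eq_setIntegral, Complex.real_smul] at e1 e2
    have hk' : Continuous fun θ => ((circlePt θ - 0) / (circlePt θ - z)) • f (circlePt θ) := by
      have := continuous_circlePt
      exact (Continuous.div (by fun_prop) (by fun_prop) (circlePt_sub_ne_zero hz)).smul hfc
    rw [← e1, ← e2]
    have hpi : ((2 * Real.pi : ℝ) : ℂ) ≠ 0 := by exact_mod_cast Real.two_pi_pos.ne'
    have : ∀ A B : ℂ, ((2 * Real.pi : ℝ) : ℂ) * (2 * ((((2 * Real.pi)⁻¹ : ℝ) : ℂ) * A) -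
        (((2 * Real.pi)⁻¹ : ℝ) : ℂ) * B) = 2 * A - B := by
      intro A B
      rw [Complex.ofReal_inv]
      field_simp
    rw [this, ← integral_const_mul, ← integral_sub]
    · refine integral_congr_ae (Eventually.of_forall fun θ => ?_)
      have := circlePt_sub_ne_zero hz θ
      simp only [smul_eq_mul]
      field_simp
      ring
    · exact ((continuous_const.mul hk').integrableOn_Ioc)
    · exact hfc.integrableOn_Ioc
  -- the conjugate-analytic half
  have h2 : ∫ θ in Set.Ioc 0 (2 * Real.pi),
      ((circlePt θ + z) / (circlePt θ - z)) * (starRingEnd ℂ) (f (circlePt θ)) =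
      (2 * Real.pi : ℝ) * (starRingEnd ℂ) (f 0) := by
    set g : ℂ → ℂ := fun w => (1 + (starRingEnd ℂ) z * w) / (1 - (starRingEnd ℂ) z * w) * f w
    have hne : ∀ w ∈ Metric.closedBall (0 : ℂ) 1, 1 - (starRingEnd ℂ) z * w ≠ 0 := by
      intro w hw h
      have h3 : ‖(starRingEnd ℂ) z * w‖ = 1 := by
        rw [← sub_eq_zero.mp h]; simp
      rw [norm_mul, RCLike.norm_conj] at h3
      have : ‖w‖ ≤ 1 := by simpa using hw
      nlinarith [norm_nonneg z, norm_nonneg w]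
    have hg : DiffContOnCl ℂ g (Metric.ball 0 1) := by
      refine DiffContOnCl.smul (𝕜' := ℂ) (F := ℂ) ?_ hf
      refine DifferentiableOn.diffContOnCl ?_
      rw [closure_ball _ one_ne_zero]
      exact DifferentiableOn.div (by fun_prop) (by fun_prop) hne
    have e3 := hg.to_abs_one.circleAverage
    have e4 := setIntegral_eq_circleAverage g
    rw [e3, Complex.real_smul] at e4
    have e5 : g 0 = f 0 := by simp [g]
    rw [e5] at e4
    have e6 := congrArg (starRingEnd ℂ) e4
    rw [← integral_conj, map_mul, Complex.conj_ofReal] at e6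
    rw [← e6]
    refine integral_congr_ae (Eventually.of_forall fun θ => ?_)
    have hu : circlePt θ * (starRingEnd ℂ) (circlePt θ) = 1 := by
      rw [Complex.mul_conj, Complex.normSq_eq_norm_sq, norm_circlePt]; simp
    have hne' := circlePt_sub_ne_zero hz θ
    have hc0 : circlePt θ ≠ 0 := by
      intro h; rw [h] at hu; simp at hu
    have hinv : (starRingEnd ℂ) (circlePt θ) = (circlePt θ)⁻¹ := by
      field_simp; rw [mul_comm]; exact hu
    simp only [g, map_mul, map_div₀, map_add, map_sub, map_one, Complex.conj_conj, hinv]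
    congr 1
    have h7 : 1 - z * (circlePt θ)⁻¹ ≠ 0 := by
      rw [show 1 - z * (circlePt θ)⁻¹ = (circlePt θ - z) * (circlePt θ)⁻¹ by field_simp]
      exact mul_ne_zero hne' (inv_ne_zero hc0)
    field_simp
  have h3 : ∫ θ in Set.Ioc 0 (2 * Real.pi),
      ((circlePt θ + z) / (circlePt θ - z)) * ((f (circlePt θ)).re : ℂ) =
      (1 / 2) * ((2 * Real.pi : ℝ) * (2 * f z - f 0) +
        (2 * Real.pi : ℝ) * (starRingEnd ℂ) (f 0)) := by
    rw [← h1, ← h2, ← integral_add, ← integral_const_mul]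
    · refine integral_congr_ae (Eventually.of_forall fun θ => ?_)
      simp only
      rw [Complex.re_eq_add_conj]
      ring
    · exact (hk.mul hfc).integrableOn_Ioc
    · exact (hk.mul (Complex.continuous_conj.comp hfc)).integrableOn_Ioc
  rw [h3, Complex.conj_eq_iff_im.mpr h0, Complex.real_smul, Complex.ofReal_inv]
  have hpi : ((2 * Real.pi : ℝ) : ℂ) ≠ 0 := by exact_mod_cast Real.two_pi_pos.ne'
  field_simp
  ring

lemma ae_circlePt_of_ae_restrict {p : ℂ → Prop}
    (h : ∀ᵐ θ ∂(volume.restrict (Set.Ioc 0 (2 * Real.pi))), p (circlePt θ)) :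
    ∀ᵐ θ : ℝ, p (circlePt θ) := by
  have hk : ∀ k : ℤ, ∀ᵐ θ : ℝ, θ + k * (2 * Real.pi) ∈ Set.Ioc 0 (2 * Real.pi) →
      p (circlePt θ) := by
    intro k
    rw [ae_restrict_iff' measurableSet_Ioc] at h
    have := (measurePreserving_add_right volume ((k : ℝ) * (2 * Real.pi))).quasiMeasurePreserving.ae h
    filter_upwards [this] with θ hθ hmem
    have h1 := hθ hmem
    rwa [(circlePt_periodic.int_mul k) θ] at h1
  filter_upwards [ae_all_iff.mpr hk] with θ hθ
  obtain ⟨k, hk, -⟩ := existsUnique_add_zsmul_mem_Ioc Real.two_pi_pos θ 0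
  refine hθ k ?_
  simpa [zsmul_eq_mul] using hk

lemma integrableOn_comp_circlePt_of_Ioc {V : Type*} [NormedAddCommGroup V] {f : ℂ → V}
    (hf : IntegrableOn (fun θ => f (circlePt θ)) (Set.Ioc 0 (2 * Real.pi))) (a b : ℝ) :
    IntegrableOn (fun θ => f (circlePt θ)) (Set.Ioo a b) := by
  have hper : Function.Periodic (fun θ => f (circlePt θ)) (2 * Real.pi) := fun θ => by
    simp only [circlePt_periodic θ]
  have h1 : IntervalIntegrable (fun θ => f (circlePt θ)) volume 0 (0 + 2 * Real.pi) := by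
    rw [zero_add, intervalIntegrable_iff_integrableOn_Ioc_of_le Real.two_pi_pos.le]
    exact hf
  have h2 := hper.intervalIntegrable Real.two_pi_pos.ne' h1 a b
  rcases le_or_gt a b with hab | hab
  · exact ((intervalIntegrable_iff_integrableOn_Ioc_of_le hab).mp h2).mono_set Ioo_subset_Ioc_self
  · simp [Set.Ioo_eq_empty hab.not_gt]

lemma meanOsc_le_of_integral_norm_sub_le {f : ℝ → ℂ} {θ₀ t A : ℝ} (ht : 0 < t)
    (hf : IntegrableOn f (Set.Ioo (θ₀ - Real.pi * t) (θ₀ + Real.pi * t))) (c : ℂ)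
    (hA : ∫ θ in Set.Ioo (θ₀ - Real.pi * t) (θ₀ + Real.pi * t), ‖f θ - c‖ ≤
      A * (2 * Real.pi * t)) :
    meanOsc f θ₀ t ≤ 2 * A := by
  set I := Set.Ioo (θ₀ - Real.pi * t) (θ₀ + Real.pi * t) with hI
  have hL : 0 < 2 * Real.pi * t := by positivity
  have hvol : volume.real I = 2 * Real.pi * t := by
    rw [hI, Real.volume_real_Ioo_of_le (by nlinarith [Real.pi_pos])]
    ring
  have hfin : volume I ≠ ⊤ := by rw [hI]; simp
  have hc : ∀ d : ℂ, IntegrableOn (fun _ : ℝ => d) I := fun d => integrableOn_const hfin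
  have hdiff : ‖c - arcAvg f θ₀ t‖ ≤ A := by
    have h1 : c - arcAvg f θ₀ t = ((2 * Real.pi * t)⁻¹ : ℝ) • ∫ θ in I, (c - f θ) := by
      rw [integral_sub (hc c) hf, smul_sub, arcAvg, ← hI]
      congr 1
      simp only [integral_const, measureReal_restrict_apply_univ, hvol, smul_smul,
        inv_mul_cancel₀ hL.ne', one_smul]
    rw [h1, norm_smul, norm_inv, Real.norm_of_nonneg hL.le]
    have h2 : ‖∫ θ in I, (c - f θ)‖ ≤ A * (2 * Real.pi * t) := by
      refine (norm_integral_le_integral_norm _).trans ?_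
      simpa only [norm_sub_rev c] using hA
    calc (2 * Real.pi * t)⁻¹ * ‖∫ θ in I, (c - f θ)‖
        ≤ (2 * Real.pi * t)⁻¹ * (A * (2 * Real.pi * t)) := by gcongr
      _ = A := by field_simp
  have h3 : ∫ θ in I, ‖f θ - arcAvg f θ₀ t‖ ≤ ∫ θ in I, (‖f θ - c‖ + A) := by
    refine integral_mono (hf.sub (hc _)).norm
      ((hf.sub (hc _)).norm.add (integrableOn_const hfin)) fun θ => ?_
    calc ‖f θ - arcAvg f θ₀ t‖ = ‖(f θ - c) + (c - arcAvg f θ₀ t)‖ := by congr 1; ring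
      _ ≤ ‖f θ - c‖ + ‖c - arcAvg f θ₀ t‖ := norm_add_le _ _
      _ ≤ ‖f θ - c‖ + A := by gcongr
  have i0 : IntegrableOn (fun θ => ‖f θ - c‖) I := (hf.sub (hc c)).norm
  rw [integral_add i0 (integrableOn_const hfin)] at h3
  simp only [integral_const, measureReal_restrict_apply_univ, hvol, smul_eq_mul] at h3
  unfold meanOsc
  rw [← hI]
  calc (2 * Real.pi * t)⁻¹ * ∫ θ in I, ‖f θ - arcAvg f θ₀ t‖
      ≤ (2 * Real.pi * t)⁻¹ * (A * (2 * Real.pi * t) + (2 * Real.pi * t) * A) := by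
        gcongr; linarith
    _ = 2 * A := by field_simp; ring

/-- An analytic function with bounded imaginary part oscillates boundedly on every arc. -/
lemma integral_norm_sub_le_of_abs_im_le {G : ℂ → ℂ} (hG : DiffContOnCl ℂ G (Metric.ball 0 1))
    {K : ℝ} (hK : 0 < K) (hIm : ∀ z ∈ Metric.closedBall (0 : ℂ) 1, |(G z).im| ≤ K)
    {θ₀ t : ℝ} (ht : 0 < t) (ht1 : t ≤ 1) :
    ∫ θ in Set.Ioo (θ₀ - Real.pi * t) (θ₀ + Real.pi * t),
      ‖G (circlePt θ) - G (((1 - t : ℝ) : ℂ) * circlePt θ₀)‖ ≤ 145 * K * (2 * Real.pi * t) := by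
  set a : ℂ := ((1 - t : ℝ) : ℂ) * circlePt θ₀ with ha_def
  have hna : ‖a‖ = 1 - t := by
    rw [ha_def, norm_mul, norm_circlePt, mul_one, Complex.norm_real,
      Real.norm_of_nonneg (by linarith)]
  have ha : ‖a‖ < 1 := by rw [hna]; linarith
  have hGc := hG.continuousOn_unitClosedBall.comp_continuous continuous_circlePt
    circlePt_mem_closedBall
  set g : ℂ → ℂ := fun z => G z - G a
  have hgd : DiffContOnCl ℂ (fun z => g z * g z) (Metric.ball 0 1) := by
    have h1 : DiffContOnCl ℂ g (Metric.ball 0 1) := hG.sub diffContOnCl_const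
    exact h1.smul h1
  have hgc : Continuous fun θ => g (circlePt θ) := hGc.sub continuous_const
  have hPc := continuous_diskPoisson ha
  have him : ∀ θ, |(g (circlePt θ)).im| ≤ 2 * K := by
    intro θ
    have h1 := hIm _ (circlePt_mem_closedBall θ)
    have h2 := hIm a (by simpa using ha.le)
    simp only [g, Complex.sub_im]
    calc _ ≤ |(G (circlePt θ)).im| + |(G a).im| := abs_sub _ _
      _ ≤ 2 * K := by linarith
  -- `∫ P_a g² = 0`
  have hz := setIntegral_diskPoisson_smul hgd ha
  have hz' : ∫ θ in Set.Ioc 0 (2 * Real.pi), diskPoisson a θ *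
      ((g (circlePt θ)).re ^ 2 - (g (circlePt θ)).im ^ 2) = 0 := by
    have h1 := congrArg Complex.re hz
    have h2 : IntegrableOn (fun θ => (diskPoisson a θ : ℂ) * (g (circlePt θ) * g (circlePt θ)))
        (Set.Ioc 0 (2 * Real.pi)) :=
      ((Complex.continuous_ofReal.comp hPc).mul (hgc.mul hgc)).integrableOn_Ioc
    have h3 := integral_re (𝕜 := ℂ) h2
    simp only [RCLike.re_eq_complex_re] at h3
    rw [← h3] at h1
    simp only [g, sub_self, mul_zero, Complex.zero_re] at h1
    refine Eq.trans (integral_congr_ae (Eventually.of_forall fun θ => ?_)) h1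
    simp [g, Complex.mul_re]
    left; ring
  have hone : ∫ θ in Set.Ioc 0 (2 * Real.pi), diskPoisson a θ = 2 * Real.pi := by
    have h1 := setIntegral_diskPoisson_smul (f := fun _ => (1 : ℂ))
      (diffContOnCl_const (c := (1 : ℂ))) ha
    simp only [mul_one] at h1
    have h2 : ∫ θ in Set.Ioc 0 (2 * Real.pi), ((diskPoisson a θ : ℝ) : ℂ) =
        ((∫ θ in Set.Ioc 0 (2 * Real.pi), diskPoisson a θ : ℝ) : ℂ) := integral_ofReal
    rw [h2] at h1
    exact_mod_cast h1
  have hsq : ∀ z : ℂ, ‖z‖ ^ 2 = (z.re ^ 2 - z.im ^ 2) + 2 * z.im ^ 2 := by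
    intro z
    rw [← Complex.normSq_eq_norm_sq, Complex.normSq_apply]; ring
  have hint : ∫ θ in Set.Ioc 0 (2 * Real.pi), diskPoisson a θ * ‖g (circlePt θ)‖ ^ 2 ≤
      16 * Real.pi * K ^ 2 := by
    have h1 : ∀ θ, diskPoisson a θ * ‖g (circlePt θ)‖ ^ 2 ≤ diskPoisson a θ *
      ((g (circlePt θ)).re ^ 2 - (g (circlePt θ)).im ^ 2) + diskPoisson a θ * (8 * K ^ 2) := by
      intro θ
      rw [hsq, ← mul_add]
      refine mul_le_mul_of_nonneg_left ?_ (diskPoisson_nonneg ha θ)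
      have h2 : (g (circlePt θ)).im ^ 2 ≤ (2 * K) ^ 2 := sq_le_sq' (by
        linarith [(abs_le.mp (him θ)).1]) (abs_le.mp (him θ)).2
      nlinarith
    have hre : Continuous fun θ => (g (circlePt θ)).re := Complex.continuous_re.comp hgc
    have him' : Continuous fun θ => (g (circlePt θ)).im := Complex.continuous_im.comp hgc
    have i1 : IntegrableOn (fun θ => diskPoisson a θ *
        ((g (circlePt θ)).re ^ 2 - (g (circlePt θ)).im ^ 2)) (Set.Ioc 0 (2 * Real.pi)) :=
      (hPc.mul ((hre.pow 2).sub (him'.pow 2))).integrableOn_Ioc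
    have i2 : IntegrableOn (fun θ => diskPoisson a θ * (8 * K ^ 2)) (Set.Ioc 0 (2 * Real.pi)) :=
      (hPc.mul continuous_const).integrableOn_Ioc
    have i3 : IntegrableOn (fun θ => diskPoisson a θ * ‖g (circlePt θ)‖ ^ 2)
        (Set.Ioc 0 (2 * Real.pi)) := (hPc.mul (hgc.norm.pow 2)).integrableOn_Ioc
    have h3 := integral_mono i3 (i1.add i2) h1
    have h4 : ∫ θ in Set.Ioc 0 (2 * Real.pi), (diskPoisson a θ *
        ((g (circlePt θ)).re ^ 2 - (g (circlePt θ)).im ^ 2) + diskPoisson a θ * (8 * K ^ 2)) =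
        16 * Real.pi * K ^ 2 := by
      rw [integral_add i1 i2, hz', integral_mul_const, hone]; ring
    exact h3.trans_eq h4
  set I := Set.Ioo (θ₀ - Real.pi * t) (θ₀ + Real.pi * t) with hI
  have hpi4 := Real.pi_lt_d2
  have hpi3 := Real.pi_gt_three
  -- lower bound for the kernel on the arc
  have hPlow : ∀ θ ∈ I, 1 ≤ 18 * t * diskPoisson a θ := by
    intro θ hθ
    have h1 : ‖circlePt θ - a‖ ≤ (Real.pi + 1) * t := by
      have h2 : circlePt θ - a = (circlePt θ - circlePt θ₀) + (t : ℂ) * circlePt θ₀ := by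
        rw [ha_def]; push_cast; ring
      rw [h2]
      refine (norm_add_le _ _).trans ?_
      rw [norm_mul, norm_circlePt, mul_one, Complex.norm_real, Real.norm_of_nonneg ht.le]
      have h3 := norm_circlePt_sub_le θ θ₀
      have h4 : |θ - θ₀| ≤ Real.pi * t := by
        rw [abs_le]; constructor <;> linarith [hθ.1, hθ.2]
      linarith
    have hp : 0 < ‖circlePt θ - a‖ := norm_pos_iff.mpr (circlePt_sub_ne_zero ha θ)
    unfold diskPoisson
    rw [hna, ← mul_div_assoc, le_div_iff₀ (by positivity), one_mul]
    have h5 : ‖circlePt θ - a‖ ^ 2 ≤ ((Real.pi + 1) * t) ^ 2 := by gcongr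
    have h6 : ((Real.pi + 1) * t) ^ 2 ≤ 18 * t ^ 2 := by
      rw [mul_pow]
      refine mul_le_mul_of_nonneg_right ?_ (sq_nonneg t)
      nlinarith
    have h7 : 18 * t ^ 2 ≤ 18 * t * (1 - (1 - t) ^ 2) := by nlinarith
    linarith
  have hvol : volume.real I = 2 * Real.pi * t := by
    rw [hI, Real.volume_real_Ioo_of_le (by nlinarith [Real.pi_pos])]
    ring
  have hfin : volume I ≠ ⊤ := by rw [hI]; simp
  have hF : Continuous fun θ => diskPoisson a θ * ‖g (circlePt θ)‖ ^ 2 :=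
    hPc.mul (hgc.norm.pow 2)
  have hshift : ∫ θ in I, diskPoisson a θ * ‖g (circlePt θ)‖ ^ 2 ≤ 16 * Real.pi * K ^ 2 := by
    refine le_trans ?_ hint
    have hper : Function.Periodic (fun θ => diskPoisson a θ * ‖g (circlePt θ)‖ ^ 2)
        (2 * Real.pi) := by
      intro θ
      simp only [diskPoisson_periodic a θ, circlePt_periodic θ]
    have h1 := hper.intervalIntegral_add_eq 0 (θ₀ - Real.pi)
    rw [intervalIntegral.integral_of_le (by linarith), zero_add,
      intervalIntegral.integral_of_le (by linarith)] at h1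
    rw [h1]
    refine setIntegral_mono_set hF.integrableOn_Ioc
      (Eventually.of_forall fun θ => mul_nonneg (diskPoisson_nonneg ha θ) (by positivity)) ?_
    refine LE.le.eventuallyLE fun θ hθ => ⟨?_, ?_⟩
    · nlinarith [hθ.1]
    · nlinarith [hθ.2]
  have hFi : IntegrableOn (fun θ => diskPoisson a θ * ‖g (circlePt θ)‖ ^ 2) I :=
    hF.integrableOn_Ioc.mono_set Ioo_subset_Ioc_self
  have hmono : ∫ θ in I, ‖g (circlePt θ)‖ ≤
      ∫ θ in I, ((9 * t / K) * (diskPoisson a θ * ‖g (circlePt θ)‖ ^ 2) + K / 2) := by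
    refine setIntegral_mono_on (hgc.norm.integrableOn_Ioc.mono_set Ioo_subset_Ioc_self)
      ((hFi.const_mul _).add (integrableOn_const hfin)) measurableSet_Ioo fun θ hθ => ?_
    have h1 := hPlow θ hθ
    have h2 : ‖g (circlePt θ)‖ ≤ ‖g (circlePt θ)‖ ^ 2 / (2 * K) + K / 2 := by
      have : ‖g (circlePt θ)‖ ^ 2 / (2 * K) + K / 2 - ‖g (circlePt θ)‖ =
        (‖g (circlePt θ)‖ - K) ^ 2 / (2 * K) := by field_simp; ring
      have h3 : 0 ≤ (‖g (circlePt θ)‖ - K) ^ 2 / (2 * K) := by positivity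
      linarith
    refine h2.trans ?_
    gcongr
    calc ‖g (circlePt θ)‖ ^ 2 / (2 * K) = 1 * (‖g (circlePt θ)‖ ^ 2 / (2 * K)) := by ring
      _ ≤ (18 * t * diskPoisson a θ) * (‖g (circlePt θ)‖ ^ 2 / (2 * K)) := by gcongr
      _ = _ := by field_simp; ring
  rw [integral_add (hFi.const_mul _) (integrableOn_const hfin), integral_const_mul] at hmono
  simp only [integral_const, measureReal_restrict_apply_univ, hvol, smul_eq_mul] at hmono
  refine hmono.trans ?_
  calc (9 * t / K) * (∫ θ in I, diskPoisson a θ * ‖g (circlePt θ)‖ ^ 2) + 2 * Real.pi * t * (K / 2)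
      ≤ (9 * t / K) * (16 * Real.pi * K ^ 2) + 2 * Real.pi * t * (K / 2) := by gcongr
    _ = (72.5 : ℝ) * K * (2 * Real.pi * t) := by field_simp; ring
    _ ≤ _ := by gcongr; norm_num

/-- `f` is the dominated almost everywhere limit on the unit circle of the functions `H n`,
which are analytic in the disc and continuous up to the boundary. -/
structure IsBoundaryLimit (H : ℕ → ℂ → ℂ) (D : ℂ → ℝ) (f : ℂ → ℂ) : Prop where
  diffContOnCl : ∀ n, DiffContOnCl ℂ (H n) (Metric.ball 0 1)
  integrableOn : IntegrableOn (fun θ => D (circlePt θ)) (Set.Ioc 0 (2 * Real.pi))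
  bound : ∀ᵐ θ ∂(volume.restrict (Set.Ioc 0 (2 * Real.pi))), ∀ n,
    ‖H n (circlePt θ)‖ ≤ D (circlePt θ)
  tendsto : ∀ᵐ θ ∂(volume.restrict (Set.Ioc 0 (2 * Real.pi))),
    Tendsto (fun n => H n (circlePt θ)) atTop (𝓝 (f (circlePt θ)))

lemma IsBoundaryLimit.continuous {H : ℕ → ℂ → ℂ} {D : ℂ → ℝ} {f : ℂ → ℂ}
    (h : IsBoundaryLimit H D f) (n : ℕ) : Continuous fun θ => H n (circlePt θ) :=
  (h.diffContOnCl n).continuousOn_unitClosedBall.comp_continuous continuous_circlePt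
    circlePt_mem_closedBall

lemma IsBoundaryLimit.aestronglyMeasurable {H : ℕ → ℂ → ℂ} {D : ℂ → ℝ} {f : ℂ → ℂ}
    (h : IsBoundaryLimit H D f) : AEStronglyMeasurable (fun θ => f (circlePt θ)) volume :=
  aestronglyMeasurable_of_tendsto_ae atTop (fun n => (h.continuous n).aestronglyMeasurable)
    (ae_circlePt_of_ae_restrict (p := fun z => Tendsto (fun n => H n z) atTop (𝓝 (f z))) h.tendsto)

lemma IsBoundaryLimit.integrable {H : ℕ → ℂ → ℂ} {D : ℂ → ℝ} {f : ℂ → ℂ}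
    (h : IsBoundaryLimit H D f) :
    IntegrableOn (fun θ => f (circlePt θ)) (Set.Ioc 0 (2 * Real.pi)) := by
  refine Integrable.mono' h.integrableOn h.aestronglyMeasurable.restrict ?_
  filter_upwards [h.bound, h.tendsto] with θ h1 h2
  exact le_of_tendsto' h2.norm h1

lemma IsBoundaryLimit.tendsto_setIntegral_mul_comp_circlePt {H : ℕ → ℂ → ℂ} {D : ℂ → ℝ} {f : ℂ → ℂ}
    (h : IsBoundaryLimit H D f)
    {k : ℝ → ℂ} (hk : Continuous k) {C : ℝ} (hC : ∀ θ, ‖k θ‖ ≤ C) :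
    Tendsto (fun n => ∫ θ in Set.Ioc 0 (2 * Real.pi), k θ * H n (circlePt θ)) atTop
      (𝓝 (∫ θ in Set.Ioc 0 (2 * Real.pi), k θ * f (circlePt θ))) := by
  refine tendsto_integral_of_dominated_convergence (fun θ => C * D (circlePt θ)) ?_
    (h.integrableOn.const_mul C) ?_ ?_
  · exact fun n => (hk.mul (h.continuous n)).aestronglyMeasurable
  · intro n
    filter_upwards [h.bound] with θ hθ
    rw [norm_mul]
    have h0 : 0 ≤ C := (norm_nonneg _).trans (hC θ)
    exact mul_le_mul (hC θ) (hθ n) (norm_nonneg _) h0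
  · filter_upwards [h.tendsto] with θ hθ
    exact hθ.const_mul _

/-- Boundary limits of analytic functions with uniformly bounded imaginary part have bounded
mean oscillation. -/
lemma IsBoundaryLimit.exists_integral_norm_sub_le {H : ℕ → ℂ → ℂ} {D : ℂ → ℝ} {f : ℂ → ℂ}
    (h : IsBoundaryLimit H D f)
    {K : ℝ} (hK : 0 < K) (hIm : ∀ n, ∀ z ∈ Metric.closedBall (0 : ℂ) 1, |(H n z).im| ≤ K)
    {θ₀ t : ℝ} (ht : 0 < t) (ht1 : t ≤ 1) :
    ∃ a c : ℂ, ‖a‖ < 1 ∧ Tendsto (fun n => H n a) atTop (𝓝 c) ∧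
      ∫ θ in Set.Ioo (θ₀ - Real.pi * t) (θ₀ + Real.pi * t), ‖f (circlePt θ) - c‖ ≤
      145 * K * (2 * Real.pi * t) := by
  set a : ℂ := ((1 - t : ℝ) : ℂ) * circlePt θ₀ with ha_def
  have ha : ‖a‖ < 1 := by
    rw [ha_def, norm_mul, norm_circlePt, mul_one, Complex.norm_real,
      Real.norm_of_nonneg (by linarith)]
    linarith
  have h1 := h.tendsto_setIntegral_mul_comp_circlePt
    (k := fun θ => (diskPoisson a θ : ℂ)) (Complex.continuous_ofReal.comp (continuous_diskPoisson ha))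
    (C := 2 / (1 - ‖a‖)) (fun θ => by
      rw [Complex.norm_real, Real.norm_of_nonneg (diskPoisson_nonneg ha θ)]
      exact diskPoisson_le ha θ)
  simp_rw [fun n => setIntegral_diskPoisson_smul (h.diffContOnCl n) ha] at h1
  have hpi : ((2 * Real.pi : ℝ) : ℂ) ≠ 0 := by exact_mod_cast Real.two_pi_pos.ne'
  have h2 := h1.const_mul (((2 * Real.pi : ℝ) : ℂ)⁻¹)
  simp only [← mul_assoc, inv_mul_cancel₀ hpi, one_mul] at h2
  obtain ⟨c, hc⟩ : ∃ c, Tendsto (fun n => H n a) atTop (𝓝 c) := ⟨_, h2⟩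
  refine ⟨a, c, ha, hc, ?_⟩
  obtain ⟨B, hB⟩ : ∃ B, ∀ n, ‖H n a‖ ≤ B := by
    obtain ⟨B, hB⟩ := hc.norm.bddAbove_range
    exact ⟨B, fun n => hB ⟨n, rfl⟩⟩
  set I := Set.Ioo (θ₀ - Real.pi * t) (θ₀ + Real.pi * t) with hI
  have hfin : volume I ≠ ⊤ := by rw [hI]; simp
  have hlim : Tendsto (fun n => ∫ θ in I, ‖H n (circlePt θ) - H n a‖) atTop
      (𝓝 (∫ θ in I, ‖f (circlePt θ) - c‖)) := by
    refine tendsto_integral_of_dominated_convergence (fun θ => D (circlePt θ) + B) ?_ ?_ ?_ ?_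
    · intro n
      exact ((h.continuous n).sub continuous_const).norm.aestronglyMeasurable
    · exact (integrableOn_comp_circlePt_of_Ioc h.integrableOn _ _).add (integrableOn_const hfin)
    · intro n
      have := ae_circlePt_of_ae_restrict (p := fun z => ∀ n, ‖H n z‖ ≤ D z) h.bound
      filter_upwards [ae_restrict_of_ae this] with θ hθ
      rw [norm_norm]
      exact (norm_sub_le _ _).trans (add_le_add (hθ n) (hB n))
    · have := ae_circlePt_of_ae_restrict
        (p := fun z => Tendsto (fun n => H n z) atTop (𝓝 (f z))) h.tendsto
      filter_upwards [ae_restrict_of_ae this] with θ hθ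
      exact (hθ.sub hc).norm
  exact le_of_tendsto' hlim fun n => integral_norm_sub_le_of_abs_im_le (h.diffContOnCl n) hK (hIm n) ht ht1

lemma abs_le_pi_div_two_mul_norm_circlePt_sub {θ φ : ℝ} (h : |φ - θ| ≤ Real.pi) :
    2 / Real.pi * |φ - θ| ≤ ‖circlePt φ - circlePt θ‖ := by
  have h1 : circlePt φ - circlePt θ =
      circlePt θ * (Complex.exp (Complex.I * ((φ - θ : ℝ) : ℂ)) - 1) := by
    rw [mul_sub, mul_one]
    congr 1
    rw [circlePt, circlePt, ← Complex.exp_add]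
    congr 1
    push_cast; ring
  rw [h1, norm_mul, norm_circlePt, one_mul, Complex.norm_exp_I_mul_ofReal_sub_one,
    norm_mul, Real.norm_of_nonneg (by norm_num : (0 : ℝ) ≤ 2), Real.norm_eq_abs]
  have h2 := Real.mul_abs_le_abs_sin (x := (φ - θ) / 2) (by
    rw [abs_div, abs_of_pos (by norm_num : (0 : ℝ) < 2)]; linarith)
  rw [abs_div, abs_of_pos (by norm_num : (0 : ℝ) < 2)] at h2
  linarith

lemma diskPoisson_radial_le {r : ℝ} (hr0 : 0 ≤ r) (hr : r < 1) {θ φ : ℝ} (h : |φ - θ| ≤ Real.pi)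
    (hne : φ ≠ θ) :
    diskPoisson ((r : ℂ) * circlePt θ) φ ≤ 2 * Real.pi ^ 2 * (1 - r) / (φ - θ) ^ 2 := by
  have hn : ‖(r : ℂ) * circlePt θ‖ = r := by
    rw [norm_mul, norm_circlePt, mul_one, Complex.norm_real, Real.norm_of_nonneg hr0]
  have h1 := abs_le_pi_div_two_mul_norm_circlePt_sub h
  have h2 : ‖circlePt φ - circlePt θ‖ ≤ 2 * ‖circlePt φ - (r : ℂ) * circlePt θ‖ := by
    have h3 : circlePt φ - circlePt θ = (circlePt φ - (r : ℂ) * circlePt θ) -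
        ((1 - r : ℝ) : ℂ) * circlePt θ := by push_cast; ring
    have h4 := one_sub_norm_le_norm_circlePt_sub ((r : ℂ) * circlePt θ) φ
    rw [hn] at h4
    rw [h3]
    refine (norm_sub_le _ _).trans ?_
    rw [norm_mul, norm_circlePt, mul_one, Complex.norm_real, Real.norm_of_nonneg (by linarith)]
    linarith
  have hx : 0 < |φ - θ| := abs_pos.mpr (sub_ne_zero.mpr hne)
  have h5 : |φ - θ| ≤ Real.pi * ‖circlePt φ - (r : ℂ) * circlePt θ‖ := by
    have h6 := h1.trans h2
    rw [div_mul_eq_mul_div, div_le_iff₀ Real.pi_pos] at h6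
    linarith
  unfold diskPoisson
  rw [hn]
  have h7 : 0 < ‖circlePt φ - (r : ℂ) * circlePt θ‖ := by
    by_contra h8
    nlinarith [Real.pi_pos, norm_nonneg (circlePt φ - (r : ℂ) * circlePt θ)]
  rw [div_le_div_iff₀ (by positivity) (by rw [← sq_abs]; positivity), ← sq_abs (φ - θ)]
  have h8 : |φ - θ| ^ 2 ≤ (Real.pi * ‖circlePt φ - (r : ℂ) * circlePt θ‖) ^ 2 := by gcongr
  have h9 : (1 - r ^ 2) ≤ 2 * (1 - r) := by nlinarith
  calc (1 - r ^ 2) * |φ - θ| ^ 2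
      ≤ (2 * (1 - r)) * (Real.pi * ‖circlePt φ - (r : ℂ) * circlePt θ‖) ^ 2 := by
        have : 0 ≤ 1 - r := by linarith
        gcongr
    _ = _ := by ring

/-- Poisson integrals of bounded functions have radial limits almost everywhere. -/
lemma ae_tendsto_poisson_radial {f : ℂ → ℂ} {B : ℝ}
    (hfm : AEStronglyMeasurable (fun θ => f (circlePt θ)) volume)
    (hfb : ∀ θ, ‖f (circlePt θ)‖ ≤ B) :
    ∀ᵐ θ : ℝ, Tendsto (fun r : ℝ => (((2 * Real.pi)⁻¹ : ℝ) : ℂ) *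
      ∫ φ in Set.Ioc 0 (2 * Real.pi),
        (diskPoisson ((r : ℂ) * circlePt θ) φ : ℂ) * f (circlePt φ))
      (𝓝[<] 1) (𝓝 (f (circlePt θ))) := by
  have hB0 : 0 ≤ B := (norm_nonneg _).trans (hfb 0)
  have hint : ∀ (s : Set ℝ), volume s ≠ ⊤ → IntegrableOn (fun θ => f (circlePt θ)) s := by
    intro s hs
    exact Measure.integrableOn_of_bounded hs hfm (Eventually.of_forall fun θ => hfb θ)
  have hloc : LocallyIntegrable (fun θ => f (circlePt θ)) volume := by
    rw [locallyIntegrable_iff]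
    exact fun k hk => hint k hk.measure_lt_top.ne
  filter_upwards [IsUnifLocDoublingMeasure.ae_tendsto_average_norm_sub volume hloc 1] with θ hθ
  rw [tendsto_iff_norm_sub_tendsto_zero]
  -- the pointwise estimate at scale `R (1 - r)`
  have key : ∀ R : ℝ, 0 < R → ∀ r : ℝ, 0 ≤ r → r < 1 →
      ‖(((2 * Real.pi)⁻¹ : ℝ) : ℂ) * (∫ φ in Set.Ioc 0 (2 * Real.pi),
        (diskPoisson ((r : ℂ) * circlePt θ) φ : ℂ) * f (circlePt φ)) - f (circlePt θ)‖ ≤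
      R * (⨍ φ in Metric.closedBall θ (R * (1 - r)), ‖f (circlePt φ) - f (circlePt θ)‖) +
        4 * Real.pi ^ 2 * B / R := by
    intro R hR r hr0 hr
    set a : ℂ := (r : ℂ) * circlePt θ with ha_def
    have hn : ‖a‖ = r := by
      rw [ha_def, norm_mul, norm_circlePt, mul_one, Complex.norm_real, Real.norm_of_nonneg hr0]
    have ha : ‖a‖ < 1 := by rw [hn]; exact hr
    have hδ : 0 < 1 - r := by linarith
    set J := Set.Ioc (θ - Real.pi) (θ + Real.pi) with hJ
    have hPc := continuous_diskPoisson ha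
    have hP0 := diskPoisson_nonneg ha
    have hJfin : volume J ≠ ⊤ := by rw [hJ]; simp
    have hPf : ∀ s : Set ℝ, volume s ≠ ⊤ →
        IntegrableOn (fun φ => (diskPoisson a φ : ℂ) * f (circlePt φ)) s := by
      intro s hs
      refine Measure.integrableOn_of_bounded (M := 2 / (1 - ‖a‖) * B) hs
        ((Complex.continuous_ofReal.comp hPc).aestronglyMeasurable.mul hfm)
        (Eventually.of_forall fun φ => ?_)
      rw [norm_mul, Complex.norm_real, Real.norm_of_nonneg (hP0 φ)]
      exact mul_le_mul (diskPoisson_le ha φ) (hfb φ) (norm_nonneg _)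
        (div_nonneg (by norm_num) (by linarith))
    have hPi : IntegrableOn (fun φ => (diskPoisson a φ : ℂ)) J :=
      (Complex.continuous_ofReal.comp hPc).integrableOn_Ioc
    have hshift : ∀ u : ℝ → ℂ, Function.Periodic u (2 * Real.pi) →
        ∫ φ in Set.Ioc 0 (2 * Real.pi), u φ = ∫ φ in J, u φ := by
      intro u hu
      have h1 := hu.intervalIntegral_add_eq 0 (θ - Real.pi)
      rw [intervalIntegral.integral_of_le (by linarith [Real.pi_pos]), zero_add,
        intervalIntegral.integral_of_le (by linarith [Real.pi_pos])] at h1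
      rw [h1, hJ]
      congr 3
      ring
    have hone : ∫ φ in J, (diskPoisson a φ : ℂ) = ((2 * Real.pi : ℝ) : ℂ) := by
      have h1 := setIntegral_diskPoisson_smul (f := fun _ => (1 : ℂ))
        (diffContOnCl_const (c := (1 : ℂ))) ha
      simp only [mul_one] at h1
      rw [← h1]
      exact (hshift _ fun φ => by simp only [diskPoisson_periodic a φ]).symm
    have hpi : ((2 * Real.pi : ℝ) : ℂ) ≠ 0 := by exact_mod_cast Real.two_pi_pos.ne'
    have hdiff : (((2 * Real.pi)⁻¹ : ℝ) : ℂ) * (∫ φ in Set.Ioc 0 (2 * Real.pi),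
        (diskPoisson a φ : ℂ) * f (circlePt φ)) - f (circlePt θ) =
        (((2 * Real.pi)⁻¹ : ℝ) : ℂ) *
          ∫ φ in J, (diskPoisson a φ : ℂ) * (f (circlePt φ) - f (circlePt θ)) := by
      rw [hshift _ fun φ => by simp only [diskPoisson_periodic a φ, circlePt_periodic φ]]
      simp_rw [mul_sub]
      rw [integral_sub (hPf J hJfin) (hPi.mul_const _), integral_mul_const, hone, mul_sub,
        Complex.ofReal_inv, inv_mul_cancel_left₀ hpi]
    rw [hdiff, norm_mul, Complex.norm_real, Real.norm_of_nonneg (by positivity)]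
    set ρ := R * (1 - r) with hρ
    have hρ0 : 0 < ρ := by positivity
    set g : ℝ → ℝ := fun φ => ‖f (circlePt φ) - f (circlePt θ)‖
    have hgB : ∀ φ, g φ ≤ 2 * B := fun φ => by
      calc g φ ≤ ‖f (circlePt φ)‖ + ‖f (circlePt θ)‖ := norm_sub_le _ _
        _ ≤ 2 * B := by linarith [hfb φ, hfb θ]
    have hg0 : ∀ φ, 0 ≤ g φ := fun φ => norm_nonneg _
    have hgi : IntegrableOn g (Metric.closedBall θ ρ) :=
      ((hint _ measure_closedBall_lt_top.ne).sub
        (integrableOn_const measure_closedBall_lt_top.ne)).norm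
    set T : ℝ → ℝ := fun φ => (Metric.closedBall θ ρ).indicator (fun φ => (2 / (1 - r)) * g φ) φ +
      (8 * Real.pi ^ 2 * B / (R * ρ)) * (1 + ((φ - θ) / ρ) ^ 2)⁻¹
    have hTi1 : Integrable
        ((Metric.closedBall θ ρ).indicator (fun φ => (2 / (1 - r)) * g φ)) :=
      (integrable_indicator_iff Metric.isClosed_closedBall.measurableSet).mpr (hgi.const_mul _)
    have hTi2 : Integrable (fun φ => (8 * Real.pi ^ 2 * B / (R * ρ)) *
        (1 + ((φ - θ) / ρ) ^ 2)⁻¹) :=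
      ((integrable_inv_one_add_sq.comp_div hρ0.ne').comp_sub_right θ).const_mul _
    have hTn : ∀ φ, 0 ≤ T φ := by
      intro φ
      refine add_nonneg (Set.indicator_nonneg (fun φ _ => mul_nonneg (by positivity) (hg0 φ)) φ) ?_
      positivity
    have hbound : ∀ φ ∈ J, ‖(diskPoisson a φ : ℂ) * (f (circlePt φ) - f (circlePt θ))‖ ≤ T φ := by
      intro φ hφ
      rw [norm_mul, Complex.norm_real, Real.norm_of_nonneg (hP0 φ)]
      change diskPoisson a φ * g φ ≤ T φ
      by_cases hmem : φ ∈ Metric.closedBall θ ρ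
      · simp only [T, Set.indicator_of_mem hmem]
        have h1 : diskPoisson a φ * g φ ≤ 2 / (1 - r) * g φ := by
          refine mul_le_mul_of_nonneg_right ?_ (hg0 φ)
          have := diskPoisson_le ha φ
          rwa [hn] at this
        have h2 : 0 ≤ (8 * Real.pi ^ 2 * B / (R * ρ)) * (1 + ((φ - θ) / ρ) ^ 2)⁻¹ := by positivity
        linarith
      · simp only [T, Set.indicator_of_notMem hmem, zero_add]
        rw [Metric.mem_closedBall, Real.dist_eq, not_le] at hmem
        have hx : |φ - θ| ≤ Real.pi := by
          rw [abs_le]; constructor <;> linarith [hφ.1, hφ.2]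
        have hne : φ ≠ θ := by
          rintro rfl
          simp only [sub_self, abs_zero] at hmem
          linarith
        have hxs : ρ ^ 2 ≤ (φ - θ) ^ 2 := by
          rw [← sq_abs (φ - θ)]; gcongr
        have hx0 : 0 < (φ - θ) ^ 2 := lt_of_lt_of_le (by positivity) hxs
        calc diskPoisson a φ * g φ
            ≤ (2 * Real.pi ^ 2 * (1 - r) / (φ - θ) ^ 2) * (2 * B) :=
              mul_le_mul (diskPoisson_radial_le hr0 hr hx hne) (hgB φ) (hg0 φ) (by positivity)
          _ = (4 * Real.pi ^ 2 * (1 - r) * B) * (1 / (φ - θ) ^ 2) := by field_simp; ring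
          _ ≤ (4 * Real.pi ^ 2 * (1 - r) * B) * (2 / (ρ ^ 2 + (φ - θ) ^ 2)) := by
              gcongr ?_ * ?_
              rw [div_le_div_iff₀ hx0 (by positivity)]
              linarith
          _ = _ := by
              have hR' : 1 - r = ρ / R := by rw [hρ]; field_simp
              rw [hR']
              field_simp
              ring
    have h1 : ‖∫ φ in J, (diskPoisson a φ : ℂ) * (f (circlePt φ) - f (circlePt θ))‖ ≤
        ∫ φ in J, T φ := by
      refine norm_integral_le_of_norm_le (hTi1.add hTi2).integrableOn ?_
      exact (ae_restrict_iff' measurableSet_Ioc).mpr (Eventually.of_forall hbound)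
    have h2 : ∫ φ in J, T φ ≤ ∫ φ, T φ :=
      setIntegral_le_integral (hTi1.add hTi2) (Eventually.of_forall hTn)
    have h3 : ∫ φ, T φ = (2 / (1 - r)) * (∫ φ in Metric.closedBall θ ρ, g φ) +
        (8 * Real.pi ^ 2 * B / (R * ρ)) * (ρ * Real.pi) := by
      simp only [T]
      rw [integral_add hTi1 hTi2, integral_indicator Metric.isClosed_closedBall.measurableSet,
        integral_const_mul, integral_const_mul]
      congr 2
      rw [integral_sub_right_eq_self (fun x => (1 + (x / ρ) ^ 2)⁻¹) θ,
        Measure.integral_comp_div (fun x => (1 + x ^ 2)⁻¹) ρ, integral_univ_inv_one_add_sq,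
        abs_of_pos hρ0, smul_eq_mul]
    have h4 : (⨍ φ in Metric.closedBall θ ρ, g φ) =
        (2 * ρ)⁻¹ * ∫ φ in Metric.closedBall θ ρ, g φ := by
      rw [setAverage_eq, Real.volume_real_closedBall hρ0.le, smul_eq_mul]
    have h5 : 0 ≤ ∫ φ in Metric.closedBall θ ρ, g φ := integral_nonneg hg0
    calc (2 * Real.pi)⁻¹ * ‖∫ φ in J, (diskPoisson a φ : ℂ) * (f (circlePt φ) - f (circlePt θ))‖
        ≤ (2 * Real.pi)⁻¹ * ((2 / (1 - r)) * (∫ φ in Metric.closedBall θ ρ, g φ) +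
        (8 * Real.pi ^ 2 * B / (R * ρ)) * (ρ * Real.pi)) := by
          rw [← h3]
          gcongr
          exact h1.trans h2
      _ = (2 / Real.pi) * (R * ((2 * ρ)⁻¹ * ∫ φ in Metric.closedBall θ ρ, g φ)) +
          4 * Real.pi ^ 2 * B / R := by
          have hR' : 1 - r = ρ / R := by rw [hρ]; field_simp
          rw [hR']
          field_simp
          ring
      _ ≤ 1 * (R * ((2 * ρ)⁻¹ * ∫ φ in Metric.closedBall θ ρ, g φ)) +
          4 * Real.pi ^ 2 * B / R := by
          gcongr
          rw [div_le_one Real.pi_pos]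
          linarith [Real.pi_gt_three]
      _ = _ := by rw [one_mul, h4]
  rw [Metric.tendsto_nhds]
  intro ε hε
  set R : ℝ := 8 * Real.pi ^ 2 * (B + 1) / ε with hR
  have hR0 : 0 < R := by positivity
  have hδ : Tendsto (fun r : ℝ => R * (1 - r)) (𝓝[<] 1) (𝓝[>] 0) := by
    refine tendsto_nhdsWithin_iff.mpr ⟨?_, ?_⟩
    · have : Tendsto (fun r : ℝ => R * (1 - r)) (𝓝 1) (𝓝 (R * (1 - 1))) :=
        (continuous_const.mul (continuous_const.sub continuous_id)).tendsto 1
      rw [sub_self, mul_zero] at this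
      exact this.mono_left nhdsWithin_le_nhds
    · filter_upwards [self_mem_nhdsWithin] with r hr
      have : r < 1 := hr
      exact mul_pos hR0 (by linarith)
  have havg := hθ (fun _ => θ) _ hδ (by
    filter_upwards [self_mem_nhdsWithin] with r hr
    have : r < 1 := hr
    rw [one_mul]
    exact Metric.mem_closedBall_self (mul_nonneg hR0.le (by linarith)))
  have havg' := havg.const_mul R
  rw [mul_zero] at havg'
  have h1 := (Metric.tendsto_nhds.mp havg') (ε / 2) (by positivity)
  have h0 : ∀ᶠ r : ℝ in 𝓝[<] 1, 0 ≤ r :=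
    nhdsWithin_le_nhds (eventually_ge_nhds (by norm_num : (0 : ℝ) < 1))
  filter_upwards [h1, h0, self_mem_nhdsWithin] with r hr1 hr0 hr
  have h2 := key R hR0 r hr0 hr
  rw [Real.dist_eq, sub_zero] at hr1 ⊢
  rw [abs_of_nonneg (norm_nonneg _)]
  have h3 := (le_abs_self _).trans_lt hr1
  have h4 : 4 * Real.pi ^ 2 * B / R < ε / 2 := by
    rw [div_lt_iff₀ hR0, hR]
    have : ε / 2 * (8 * Real.pi ^ 2 * (B + 1) / ε) = 4 * Real.pi ^ 2 * (B + 1) := by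
      field_simp; ring
    rw [this]
    have := Real.pi_pos
    gcongr
    linarith
  linarith

section CarlesonEstimate

open scoped ENNReal ComplexConjugate

/-- A sublevel set of a distribution function has the obvious measure bound. -/
lemma measure_setOf_measure_Iic_le (σ : Measure ℝ) (s : ℝ≥0∞) :
    σ {c | σ (Set.Iic c) ≤ s} ≤ s := by
  set B : Set ℝ := {c | σ (Set.Iic c) ≤ s} with hB
  have hlow : ∀ x y : ℝ, x ≤ y → y ∈ B → x ∈ B := fun x y hxy hy =>
    (measure_mono (Set.Iic_subset_Iic.2 hxy)).trans hy
  by_cases hmax : ∃ c ∈ B, ∀ x ∈ B, x ≤ c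
  · obtain ⟨c, hc, hcB⟩ := hmax
    exact (measure_mono hcB).trans hc
  · push Not at hmax
    have hsub : B ⊆ ⋃ q : {q : ℚ // (q : ℝ) ∈ B}, Set.Iic ((q : ℚ) : ℝ) := by
      intro x hx
      obtain ⟨y, hy, hxy⟩ := hmax x hx
      obtain ⟨q, hxq, hqy⟩ := exists_rat_btwn hxy
      exact Set.mem_iUnion.2 ⟨⟨q, hlow _ _ hqy.le hy⟩, hxq.le⟩
    refine (measure_mono hsub).trans ?_
    rw [Directed.measure_iUnion]
    · exact iSup_le fun q => q.2
    · refine directed_of_isDirected_le fun p q hpq => Set.Iic_subset_Iic.2 ?_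
      exact_mod_cast hpq

lemma lintegral_inv_sq_measure_Iic_le (σ : Measure ℝ) :
    ∫⁻ c, ((1 + σ (Set.Iic c)) ^ 2)⁻¹ ∂σ ≤ 8 := by
  have hmono : Monotone fun c : ℝ => σ (Set.Iic c) :=
    fun x y hxy => measure_mono (Set.Iic_subset_Iic.2 hxy)
  have hmeas : ∀ n : ℕ, MeasurableSet {c : ℝ | σ (Set.Iic c) ≤ 2 ^ n} := fun n =>
    hmono.measurable measurableSet_Iic
  have hpt : ∀ c : ℝ, ((1 + σ (Set.Iic c)) ^ 2)⁻¹ ≤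
      ∑' n : ℕ, {c : ℝ | σ (Set.Iic c) ≤ 2 ^ n}.indicator (fun _ => 4 * ((2 ^ n) ^ 2)⁻¹) c := by
    intro c
    by_cases htop : σ (Set.Iic c) = ⊤
    · simp [htop]
    have hex : ∃ n : ℕ, σ (Set.Iic c) ≤ 2 ^ n := by
      obtain ⟨n, hn⟩ := ENNReal.exists_nat_gt htop
      refine ⟨n, hn.le.trans ?_⟩
      exact_mod_cast n.lt_two_pow_self.le
    classical
    have hspec := Nat.find_spec hex
    refine le_trans ?_ (ENNReal.le_tsum (Nat.find hex))
    rw [Set.indicator_of_mem (by exact hspec)]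
    rcases hk : Nat.find hex with _ | k
    · have h1 : ((1 + σ (Set.Iic c)) ^ 2)⁻¹ ≤ 1 :=
        ENNReal.inv_le_one.2 (one_le_pow_of_one_le' le_self_add 2)
      refine h1.trans ?_
      norm_num
    · have hlt : 2 ^ k < σ (Set.Iic c) := by
        have := Nat.find_min hex (m := k) (by omega)
        exact not_le.1 this
      have h1 : ((1 + σ (Set.Iic c)) ^ 2)⁻¹ ≤ (((2 : ℝ≥0∞) ^ k) ^ 2)⁻¹ := by
        refine ENNReal.inv_le_inv.2 ?_
        gcongr
        exact hlt.le.trans le_add_self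
      refine h1.trans_eq ?_
      have : ((2 : ℝ≥0∞) ^ (k + 1)) ^ 2 = 4 * (2 ^ k) ^ 2 := by ring
      rw [this, ENNReal.mul_inv (by norm_num) (by norm_num), ← mul_assoc,
        ENNReal.mul_inv_cancel (by norm_num) (by norm_num), one_mul]
  calc ∫⁻ c, ((1 + σ (Set.Iic c)) ^ 2)⁻¹ ∂σ
      ≤ ∫⁻ c, ∑' n : ℕ, {c : ℝ | σ (Set.Iic c) ≤ 2 ^ n}.indicator
          (fun _ => 4 * ((2 ^ n) ^ 2)⁻¹) c ∂σ := lintegral_mono hpt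
    _ = ∑' n : ℕ, (4 * ((2 ^ n) ^ 2)⁻¹) * σ {c : ℝ | σ (Set.Iic c) ≤ 2 ^ n} := by
        rw [lintegral_tsum fun n => (measurable_const.indicator (hmeas n)).aemeasurable]
        refine tsum_congr fun n => ?_
        rw [lintegral_indicator_const (hmeas n)]
    _ ≤ ∑' n : ℕ, 4 * (2⁻¹ : ℝ≥0∞) ^ n := by
        refine ENNReal.tsum_le_tsum fun n => ?_
        refine (mul_le_mul_right (measure_setOf_measure_Iic_le σ (2 ^ n)) _).trans_eq ?_
        rw [mul_assoc, sq, ENNReal.mul_inv (by simp) (by simp), mul_assoc,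
          ENNReal.inv_mul_cancel (by simp) (by simp), mul_one, ENNReal.inv_pow]
    _ = 8 := by
        rw [ENNReal.tsum_mul_left, ENNReal.tsum_geometric, ENNReal.one_sub_inv_two, inv_inv]
        norm_num

lemma lintegral_inv_sq_measure_le {X : Type*} [MeasurableSpace X] (τ : Measure X) {r : X → ℝ}
    (hr : Measurable r) : ∫⁻ x, ((1 + τ {y | r y ≤ r x}) ^ 2)⁻¹ ∂τ ≤ 8 := by
  have hmono : Monotone fun c : ℝ => (τ.map r) (Set.Iic c) :=
    fun x y hxy => measure_mono (Set.Iic_subset_Iic.2 hxy)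
  refine le_trans (le_of_eq ?_) (lintegral_inv_sq_measure_Iic_le (τ.map r))
  have hm : Measurable fun c : ℝ => ((1 + (τ.map r) (Set.Iic c)) ^ 2)⁻¹ :=
    ((hmono.measurable.const_add 1).pow_const 2).inv
  rw [lintegral_map hm hr]
  refine lintegral_congr fun x => ?_
  rw [Measure.map_apply hr measurableSet_Iic]
  rfl

/-- The potential `∫ Re 1/(1 - conj w z) dν(w)`. -/
def cauchyPotential (ν : Measure ℂ) (z : ℂ) : ℝ≥0∞ :=
  ∫⁻ w, ENNReal.ofReal (1 / (1 - conj w * z)).re ∂ν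

lemma measurable_cauchyPotential (ν : Measure ℂ) [SFinite ν] :
    Measurable (cauchyPotential ν) := by
  unfold cauchyPotential
  refine Measurable.lintegral_prod_right ?_
  fun_prop

/-- In a nontangential cone, the Cauchy kernel has a large real part. -/
lemma re_cauchyKernel_ge {θ : ℝ} {w z : ℂ} (hw : ‖circlePt θ - w‖ ≤ 2 * (1 - ‖w‖))
    (hz : ‖circlePt θ - z‖ ≤ 2 * (1 - ‖z‖)) (hwz : ‖w‖ ≤ ‖z‖) (hz1 : ‖z‖ < 1) :
    1 / (16 * (1 - ‖w‖)) ≤ (1 / (1 - conj w * z)).re := by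
  have hw1 : 0 < 1 - ‖w‖ := by linarith
  set u : ℂ := 1 - conj w * z with hu
  have hre : 1 - ‖w‖ ≤ u.re := by
    have h1 : (conj w * z).re ≤ ‖conj w * z‖ := Complex.re_le_norm _
    rw [norm_mul, RCLike.norm_conj] at h1
    have h2 : ‖w‖ * ‖z‖ ≤ ‖w‖ := mul_le_of_le_one_right (norm_nonneg _) hz1.le
    simp only [hu, Complex.sub_re, Complex.one_re]
    linarith
  have hnorm : ‖u‖ ≤ 4 * (1 - ‖w‖) := by
    have hone : conj (circlePt θ) * circlePt θ = 1 := by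
      rw [mul_comm, Complex.mul_conj, Complex.normSq_eq_norm_sq, norm_circlePt]; simp
    have h1 : u = (conj (circlePt θ - w)) * circlePt θ + conj w * (circlePt θ - z) := by
      rw [map_sub, sub_mul, hone, hu]; ring
    have h2 : ‖u‖ ≤ ‖circlePt θ - w‖ + ‖w‖ * ‖circlePt θ - z‖ := by
      rw [h1]
      refine (norm_add_le _ _).trans_eq ?_
      rw [norm_mul, norm_mul, RCLike.norm_conj, RCLike.norm_conj, norm_circlePt, mul_one]
    have h3 : ‖w‖ * ‖circlePt θ - z‖ ≤ ‖circlePt θ - z‖ :=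
      mul_le_of_le_one_left (norm_nonneg _) (by linarith)
    linarith
  have hpos : 0 < ‖u‖ := by
    have := Complex.re_le_norm u
    linarith
  rw [one_div u, Complex.inv_re, Complex.normSq_eq_norm_sq, div_le_div_iff₀ (by positivity)
    (by positivity)]
  have h4 : ‖u‖ ^ 2 ≤ (4 * (1 - ‖w‖)) ^ 2 := by gcongr
  nlinarith [mul_le_mul_of_nonneg_right hre hw1.le]

/-- Carleson measure estimate for the weight `(1 + S)⁻²`, `S` the potential of the measure. -/
lemma setLIntegral_cauchyPotential_carlesonSquare_le (ν : Measure ℂ) [SFinite ν] (θ₀ : ℝ) {t : ℝ}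
    (ht : 0 < t) :
    ∫⁻ z in carlesonSquare θ₀ t, ((1 + cauchyPotential ν z) ^ 2)⁻¹ ∂ν ≤
      ENNReal.ofReal (640 * t) := by
  set g : ℂ → ℝ≥0∞ := fun z => ((1 + cauchyPotential ν z) ^ 2)⁻¹ with hg
  have hgm : Measurable g := (((measurable_cauchyPotential ν).const_add 1).pow_const 2).inv
  set d : ℂ → ℝ≥0∞ := fun z => ENNReal.ofReal (1 / (16 * (1 - ‖z‖))) with hd
  have hdm : Measurable d := by fun_prop
  set I : Set ℝ := Set.Icc (θ₀ - 5 * t) (θ₀ + 5 * t) with hI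
  set T : Set (ℝ × ℂ) := {p | ‖p.2‖ < 1 ∧ ‖circlePt p.1 - p.2‖ ≤ 2 * (1 - ‖p.2‖)} with hT
  have hTm : MeasurableSet T := by
    have hc := continuous_circlePt
    exact (measurableSet_lt (f := fun p : ℝ × ℂ => ‖p.2‖) (by fun_prop) measurable_const).inter
      (measurableSet_le (f := fun p : ℝ × ℂ => ‖circlePt p.1 - p.2‖) (by fun_prop)
        (g := fun p : ℝ × ℂ => 2 * (1 - ‖p.2‖)) (by fun_prop))
  set k : ℝ → ℂ → ℝ≥0∞ := fun θ z => T.indicator (fun p => 8 * (d p.2 * g p.2)) (θ, z) with hk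
  have hkm : Measurable (Function.uncurry k) := by
    have : Measurable (T.indicator fun p : ℝ × ℂ => 8 * (d p.2 * g p.2)) :=
      Measurable.indicator (by fun_prop) hTm
    exact this
  have hlow : ∀ z ∈ carlesonSquare θ₀ t, g z ≤ ∫⁻ θ in I, k θ z := by
    rintro z ⟨hz1, hzt, α, hα, hzα⟩
    have hz1 : ‖z‖ < 1 := hz1
    set δ := 1 - ‖z‖ with hδ
    have hδ0 : 0 < δ := by linarith
    have hJI : Set.Icc (α - δ) (α + δ) ⊆ I := by
      have h1 := abs_le.1 hα
      have h2 : Real.pi * t ≤ 4 * t := by gcongr; exact Real.pi_le_four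
      exact Set.Icc_subset_Icc (by linarith) (by linarith)
    have hJ : ∀ θ ∈ Set.Icc (α - δ) (α + δ), k θ z = 8 * (d z * g z) := by
      intro θ hθ
      refine Set.indicator_of_mem (show (θ, z) ∈ T from ⟨hz1, ?_⟩) _
      have h1 : ‖circlePt α - z‖ = δ := by
        conv_lhs => rw [hzα]
        rw [show circlePt α - (‖z‖ : ℂ) * circlePt α = ((1 - ‖z‖ : ℝ) : ℂ) * circlePt α by
          push_cast; ring, norm_mul, norm_circlePt, mul_one, Complex.norm_real,
          Real.norm_of_nonneg hδ0.le]
      have h2 := norm_circlePt_sub_le θ α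
      have h3 : |θ - α| ≤ δ := abs_le.2 ⟨by linarith [hθ.1], by linarith [hθ.2]⟩
      have h4 := norm_sub_le_norm_sub_add_norm_sub (circlePt θ) (circlePt α) z
      show ‖circlePt θ - z‖ ≤ 2 * δ
      linarith
    calc g z = ∫⁻ θ in Set.Icc (α - δ) (α + δ), 8 * (d z * g z) := by
          rw [setLIntegral_const, Real.volume_Icc]
          have h5 : 8 * d z * ENNReal.ofReal (α + δ - (α - δ)) = 1 := by
            rw [hd, show (8 : ℝ≥0∞) = ENNReal.ofReal 8 by norm_num,
              ← ENNReal.ofReal_mul (by norm_num), ← ENNReal.ofReal_mul (by positivity)]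
            rw [← ENNReal.ofReal_one]
            congr 1
            rw [← hδ]
            field_simp
            ring
          calc g z = (8 * d z * ENNReal.ofReal (α + δ - (α - δ))) * g z := by rw [h5, one_mul]
            _ = _ := by ring
      _ = ∫⁻ θ in Set.Icc (α - δ) (α + δ), k θ z :=
          (setLIntegral_congr_fun measurableSet_Icc fun θ hθ => hJ θ hθ).symm
      _ ≤ ∫⁻ θ in I, k θ z := lintegral_mono_set hJI
  have hin : ∀ θ, ∫⁻ z, k θ z ∂ν ≤ 64 := by
    intro θ
    set Γ : Set ℂ := {z | (θ, z) ∈ T} with hΓ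
    have hΓm : MeasurableSet Γ := measurable_prodMk_left hTm
    set τ : Measure ℂ := (ν.withDensity d).restrict Γ with hτ
    have hS : ∀ z ∈ Γ, τ {w | ‖w‖ ≤ ‖z‖} ≤ cauchyPotential ν z := by
      intro z hz
      have hm : MeasurableSet {w : ℂ | ‖w‖ ≤ ‖z‖} :=
        measurableSet_le (by fun_prop) measurable_const
      rw [hτ, Measure.restrict_apply hm, withDensity_apply _ (hm.inter hΓm), cauchyPotential]
      refine le_trans ?_ (setLIntegral_le_lintegral ({w : ℂ | ‖w‖ ≤ ‖z‖} ∩ Γ) _)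
      refine setLIntegral_mono' (hm.inter hΓm) fun w hw => ENNReal.ofReal_le_ofReal ?_
      exact re_cauchyKernel_ge hw.2.2 hz.2 hw.1 hz.1
    have h1 : ∀ z, k θ z = Γ.indicator (fun z => 8 * (d z * g z)) z := fun z => rfl
    calc ∫⁻ z, k θ z ∂ν = ∫⁻ z in Γ, 8 * (d z * g z) ∂ν := by
          simp_rw [h1]; rw [lintegral_indicator hΓm]
      _ = 8 * ∫⁻ z in Γ, d z * g z ∂ν := lintegral_const_mul _ (hdm.mul hgm)
      _ = 8 * ∫⁻ z, g z ∂τ := by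
          rw [hτ, restrict_withDensity hΓm, lintegral_withDensity_eq_lintegral_mul _ hdm hgm]
          rfl
      _ ≤ 8 * ∫⁻ z, ((1 + τ {w | ‖w‖ ≤ ‖z‖}) ^ 2)⁻¹ ∂τ := by
          gcongr 8 * ?_
          rw [hτ]
          refine setLIntegral_mono_ae' hΓm (Eventually.of_forall fun z hz => ?_)
          refine ENNReal.inv_le_inv.2 ?_
          gcongr
          exact hS z hz
      _ ≤ 8 * 8 := by
          gcongr
          exact lintegral_inv_sq_measure_le τ measurable_norm
      _ = 64 := by norm_num
  calc ∫⁻ z in carlesonSquare θ₀ t, g z ∂ν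
      ≤ ∫⁻ z in carlesonSquare θ₀ t, (∫⁻ θ in I, k θ z) ∂ν := by
        refine setLIntegral_mono ?_ hlow
        exact hkm.lintegral_prod_left
    _ ≤ ∫⁻ z, (∫⁻ θ in I, k θ z) ∂ν := setLIntegral_le_lintegral _ _
    _ = ∫⁻ θ in I, ∫⁻ z, k θ z ∂ν := lintegral_lintegral_swap (by
        exact (hkm.comp measurable_swap).aemeasurable)
    _ ≤ ∫⁻ _ in I, 64 := lintegral_mono hin
    _ = ENNReal.ofReal (640 * t) := by
        rw [setLIntegral_const, hI, Real.volume_Icc, show (64 : ℝ≥0∞) = ENNReal.ofReal 64 by norm_num,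
          ← ENNReal.ofReal_mul (by norm_num)]
        congr 1
        ring

end CarlesonEstimate

section OuterFunctions

/-- The outer function with boundary modulus `exp (h (circlePt θ))`. -/
def outerExp (h : ℂ → ℝ) (z : ℂ) : ℂ :=
  Complex.exp (((2 * Real.pi)⁻¹ : ℝ) • ∫ θ in Set.Ioc 0 (2 * Real.pi),
    ((circlePt θ + z) / (circlePt θ - z)) * (h (circlePt θ) : ℂ))

lemma continuous_herglotz {z : ℂ} (hz : ‖z‖ < 1) :
    Continuous fun θ => (circlePt θ + z) / (circlePt θ - z) := by
  have := continuous_circlePt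
  exact Continuous.div (by fun_prop) (by fun_prop) (circlePt_sub_ne_zero hz)

lemma norm_herglotz_le {z : ℂ} (hz : ‖z‖ < 1) (θ : ℝ) :
    ‖(circlePt θ + z) / (circlePt θ - z)‖ ≤ 2 / (1 - ‖z‖) := by
  rw [norm_div]
  have h1 := one_sub_norm_le_norm_circlePt_sub z θ
  have h2 : ‖circlePt θ + z‖ ≤ 2 := by
    refine (norm_add_le _ _).trans ?_
    rw [norm_circlePt]; linarith
  exact div_le_div₀ (by norm_num) h2 (by linarith) h1

lemma isOuter_outerExp {h : ℂ → ℝ}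
    (hi : IntegrableOn (fun θ => h (circlePt θ)) (Set.Ioc 0 (2 * Real.pi))) :
    IsOuter (outerExp h) := by
  refine ⟨?_, fun θ => h (circlePt θ), hi, fun z _ => rfl⟩
  have hci : CircleIntegrable (fun ζ => (h ζ : ℂ)) 0 1 := by
    unfold CircleIntegrable
    rw [intervalIntegrable_iff_integrableOn_Ioc_of_le Real.two_pi_pos.le]
    simp only [← circlePt_eq_circleMap]
    exact hi.ofReal
  have hd := differentiableOn_circleAverage_herglotzRieszKernel_smul hci
  have hball : unitDisc = Metric.ball (0 : ℂ) 1 := by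
    ext z; simp [unitDisc]
  rw [hball]
  refine DifferentiableOn.cexp (hd.congr fun z _ => ?_)
  rw [circleAverage_eq_setIntegral]
  simp [herglotzRieszKernel_def]

variable {H : ℕ → ℂ → ℂ} {D : ℂ → ℝ} {f : ℂ → ℂ}

lemma IsBoundaryLimit.tendsto_exp_neg (h : IsBoundaryLimit H D f) (h0 : ∀ n, (H n 0).im = 0)
    {z : ℂ} (hz : ‖z‖ < 1) :
    Tendsto (fun n => Complex.exp (-H n z)) atTop (𝓝 (outerExp (fun ζ => -(f ζ).re) z)) := by
  have h1 : Tendsto (fun n => ∫ θ in Set.Ioc 0 (2 * Real.pi),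
      ((circlePt θ + z) / (circlePt θ - z)) * ((H n (circlePt θ)).re : ℂ)) atTop
      (𝓝 (∫ θ in Set.Ioc 0 (2 * Real.pi),
        ((circlePt θ + z) / (circlePt θ - z)) * ((f (circlePt θ)).re : ℂ))) := by
    refine tendsto_integral_of_dominated_convergence
      (fun θ => 2 / (1 - ‖z‖) * D (circlePt θ)) ?_ (h.integrableOn.const_mul _) ?_ ?_
    · exact fun n => ((continuous_herglotz hz).mul (Complex.continuous_ofReal.comp
        (Complex.continuous_re.comp (h.continuous n)))).aestronglyMeasurable
    · intro n
      filter_upwards [h.bound] with θ hθ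
      rw [norm_mul, Complex.norm_real]
      exact mul_le_mul (norm_herglotz_le hz θ) ((Complex.abs_re_le_norm _).trans (hθ n))
        (norm_nonneg _) (div_nonneg (by norm_num) (by linarith))
    · filter_upwards [h.tendsto] with θ hθ
      exact ((Complex.continuous_ofReal.tendsto _).comp
        ((Complex.continuous_re.tendsto _).comp hθ)).const_mul _
  have h2 := (h1.const_smul ((2 * Real.pi)⁻¹ : ℝ)).neg
  simp_rw [← fun n => eq_setIntegral_herglotz_re (h.diffContOnCl n) (h0 n) hz] at h2
  have h3 : outerExp (fun ζ => -(f ζ).re) z = Complex.exp (-(((2 * Real.pi)⁻¹ : ℝ) •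
      ∫ θ in Set.Ioc 0 (2 * Real.pi),
        ((circlePt θ + z) / (circlePt θ - z)) * ((f (circlePt θ)).re : ℂ))) := by
    simp only [outerExp, Complex.ofReal_neg, mul_neg, integral_neg, smul_neg]
  rw [h3]
  exact (Complex.continuous_exp.tendsto _).comp h2

lemma norm_exp_neg_le_one {w : ℂ} (hw : 0 ≤ w.re) : ‖Complex.exp (-w)‖ ≤ 1 := by
  rw [Complex.norm_exp, Complex.neg_re]
  exact Real.exp_le_one_iff.2 (by linarith)

lemma IsBoundaryLimit.exp_neg (h : IsBoundaryLimit H D f)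
    (hre : ∀ n, ∀ z ∈ Metric.closedBall (0 : ℂ) 1, 0 ≤ (H n z).re) :
    IsBoundaryLimit (fun n z => Complex.exp (-H n z)) (fun _ => 1)
      (fun z => Complex.exp (-f z)) where
  diffContOnCl n := Complex.differentiable_exp.comp_diffContOnCl (h.diffContOnCl n).neg
  integrableOn := integrableOn_const measure_Ioc_lt_top.ne
  bound := Eventually.of_forall fun θ n =>
    norm_exp_neg_le_one (hre n _ (circlePt_mem_closedBall θ))
  tendsto := by
    filter_upwards [h.tendsto] with θ hθ
    exact (Complex.continuous_exp.tendsto _).comp hθ.neg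

/-- The exponential of minus a boundary limit of functions with nonnegative real part is the
boundary function of a bounded outer function. -/
lemma IsBoundaryLimit.hasRadialLimits (h : IsBoundaryLimit H D f) (h0 : ∀ n, (H n 0).im = 0)
    (hre : ∀ n, ∀ z ∈ Metric.closedBall (0 : ℂ) 1, 0 ≤ (H n z).re)
    (hf : ∀ θ, 0 ≤ (f (circlePt θ)).re) :
    HasRadialLimits (outerExp fun ζ => -(f ζ).re) (fun θ => Complex.exp (-f (circlePt θ))) := by
  have he := h.exp_neg hre
  have hP : ∀ a : ℂ, ‖a‖ < 1 → outerExp (fun ζ => -(f ζ).re) a = (((2 * Real.pi)⁻¹ : ℝ) : ℂ) *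
      ∫ φ in Set.Ioc 0 (2 * Real.pi),
        (diskPoisson a φ : ℂ) * Complex.exp (-f (circlePt φ)) := by
    intro a ha
    have h1 := he.tendsto_setIntegral_mul_comp_circlePt
      (k := fun θ => (diskPoisson a θ : ℂ))
      (Complex.continuous_ofReal.comp (continuous_diskPoisson ha))
      (C := 2 / (1 - ‖a‖)) (fun θ => by
        rw [Complex.norm_real, Real.norm_of_nonneg (diskPoisson_nonneg ha θ)]
        exact diskPoisson_le ha θ)
    simp_rw [fun n => setIntegral_diskPoisson_smul (he.diffContOnCl n) ha] at h1
    have h2 := tendsto_nhds_unique h1 ((h.tendsto_exp_neg h0 ha).const_mul _)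
    rw [h2, ← mul_assoc, ← Complex.ofReal_mul, inv_mul_cancel₀ Real.two_pi_pos.ne',
      Complex.ofReal_one, one_mul]
  have h3 := ae_tendsto_poisson_radial (f := fun z => Complex.exp (-f z)) (B := 1) he.aestronglyMeasurable
    fun θ => norm_exp_neg_le_one (hf θ)
  filter_upwards [ae_restrict_of_ae h3] with θ hθ
  refine hθ.congr' ?_
  filter_upwards [Ioo_mem_nhdsLT (show (0 : ℝ) < 1 by norm_num)] with r hr
  refine (hP _ ?_).symm
  rw [norm_mul, norm_circlePt, mul_one, Complex.norm_real, Real.norm_of_nonneg hr.1.le]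
  exact hr.2

lemma IsBoundaryLimit.norm_outerExp_le (h : IsBoundaryLimit H D f) (h0 : ∀ n, (H n 0).im = 0)
    {z : ℂ} (hz : ‖z‖ < 1) {b : ℝ} (hb : ∀ᶠ n in atTop, ‖Complex.exp (-H n z)‖ ≤ b) :
    ‖outerExp (fun ζ => -(f ζ).re) z‖ ≤ b :=
  le_of_tendsto (h.tendsto_exp_neg h0 hz).norm hb

lemma IsBoundaryLimit.memHinf (h : IsBoundaryLimit H D f) (h0 : ∀ n, (H n 0).im = 0)
    (hre : ∀ n, ∀ z ∈ Metric.closedBall (0 : ℂ) 1, 0 ≤ (H n z).re) :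
    MemHinf (outerExp fun ζ => -(f ζ).re) := by
  refine ⟨(isOuter_outerExp (h := fun ζ => -(f ζ).re) h.integrable.re.neg).1, 1, fun z hz => ?_⟩
  have hz : ‖z‖ < 1 := hz
  refine h.norm_outerExp_le h0 hz (Eventually.of_forall fun n => norm_exp_neg_le_one ?_)
  exact hre n z (by simpa using hz.le)

/-- A boundary limit of functions with bounded imaginary part has real part in BMO. -/
lemma IsBoundaryLimit.isBMO_log_norm_exp_neg (h : IsBoundaryLimit H D f) {K : ℝ} (hK : 0 < K)
    (hIm : ∀ n, ∀ z ∈ Metric.closedBall (0 : ℂ) 1, |(H n z).im| ≤ K) :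
    IsBMO fun θ => ((Real.log ‖Complex.exp (-f (circlePt θ))‖ : ℝ) : ℂ) := by
  have hlog : (fun θ => ((Real.log ‖Complex.exp (-f (circlePt θ))‖ : ℝ) : ℂ)) =
      fun θ => ((-(f (circlePt θ)).re : ℝ) : ℂ) := by
    funext θ
    rw [Complex.norm_exp, Real.log_exp, Complex.neg_re]
  rw [hlog]
  have hint : IntegrableOn (fun θ => ((-(f (circlePt θ)).re : ℝ) : ℂ))
      (Set.Ioc 0 (2 * Real.pi)) := h.integrable.re.neg.ofReal
  refine ⟨fun θ => by simp only [circlePt_periodic θ], hint, 2 * (145 * K), ?_⟩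
  intro θ₀ t ht ht1
  obtain ⟨-, c, -, -, hc⟩ := h.exists_integral_norm_sub_le hK hIm (θ₀ := θ₀) ht ht1
  set I := Set.Ioo (θ₀ - Real.pi * t) (θ₀ + Real.pi * t) with hI
  have hfin : volume I ≠ ⊤ := by rw [hI]; simp
  have hintI := integrableOn_comp_circlePt_of_Ioc
    (f := fun ζ => ((-(f ζ).re : ℝ) : ℂ)) hint (θ₀ - Real.pi * t) (θ₀ + Real.pi * t)
  refine meanOsc_le_of_integral_norm_sub_le ht hintI ((-c.re : ℝ) : ℂ) (le_trans ?_ hc)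
  refine integral_mono (hintI.sub (integrableOn_const hfin)).norm
    ((integrableOn_comp_circlePt_of_Ioc h.integrable _ _).sub (integrableOn_const hfin)).norm
    fun θ => ?_
  show ‖((-(f (circlePt θ)).re : ℝ) : ℂ) - ((-c.re : ℝ) : ℂ)‖ ≤ ‖f (circlePt θ) - c‖
  rw [← Complex.ofReal_sub, Complex.norm_real, Real.norm_eq_abs,
    show -(f (circlePt θ)).re - -c.re = -(f (circlePt θ) - c).re by simp; ring, abs_neg]
  exact Complex.abs_re_le_norm _

lemma norm_exp_neg_sub_exp_neg_le {z w : ℂ} (hz : 0 ≤ z.re) (hw : 0 ≤ w.re) :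
    ‖Complex.exp (-z) - Complex.exp (-w)‖ ≤ ‖z - w‖ := by
  have h := Convex.norm_image_sub_le_of_norm_hasDerivWithin_le (f := Complex.exp)
    (f' := Complex.exp) (s := {u : ℂ | u.re ≤ 0}) (C := 1) (x := -w) (y := -z)
    (fun u _ => (Complex.hasDerivAt_exp u).hasDerivWithinAt)
    (fun u hu => by
      rw [Complex.norm_exp]; exact Real.exp_le_one_iff.2 hu)
    (convex_halfSpace_re_le 0) (by simpa using hw) (by simpa using hz)
  refine h.trans_eq ?_
  rw [one_mul, show -z - -w = -(z - w) by ring, norm_neg]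

/-- A bounded boundary function which is close to `exp (-τ) Y` with `τ` of small bounded mean
oscillation and `Y` continuous has small mean oscillation on short arcs. -/
lemma IsBoundaryLimit.exists_meanOsc_le (h : IsBoundaryLimit H D f) {K : ℝ} (hK : 0 < K)
    (hre : ∀ n, ∀ z ∈ Metric.closedBall (0 : ℂ) 1, 0 ≤ (H n z).re)
    (hIm : ∀ n, ∀ z ∈ Metric.closedBall (0 : ℂ) 1, |(H n z).im| ≤ K)
    (hf : ∀ θ, 0 ≤ (f (circlePt θ)).re)
    {Y : ℂ → ℂ} (hY : ContinuousOn Y (Metric.closedBall 0 1))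
    (hY1 : ∀ θ, ‖Y (circlePt θ)‖ ≤ 1) {g : ℂ → ℂ} {s : ℝ}
    (hgi : IntegrableOn (fun θ => g (circlePt θ)) (Set.Ioc 0 (2 * Real.pi)))
    (hg : ∀ᵐ θ ∂(volume.restrict (Set.Ioc 0 (2 * Real.pi))),
      ‖g (circlePt θ) - Complex.exp (-f (circlePt θ)) * Y (circlePt θ)‖ ≤ s)
    {ε : ℝ} (hε : 0 < ε) :
    ∃ δ, 0 < δ ∧ ∀ θ₀ t : ℝ, 0 < t → t < δ →
      meanOsc (fun θ => g (circlePt θ)) θ₀ t ≤ 2 * (s + 145 * K + ε) := by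
  obtain ⟨η, hη, hYη⟩ := Metric.uniformContinuousOn_iff.1
    ((isCompact_closedBall (0 : ℂ) 1).uniformContinuousOn_of_continuous hY) ε hε
  refine ⟨min 1 (η / Real.pi), lt_min one_pos (by positivity), fun θ₀ t ht htδ => ?_⟩
  have ht1 : t ≤ 1 := (htδ.trans_le (min_le_left _ _)).le
  have htη : Real.pi * t < η := by
    have := htδ.trans_le (min_le_right _ _)
    rw [lt_div_iff₀ Real.pi_pos] at this
    linarith
  obtain ⟨a, c, ha, hac, hc⟩ := h.exists_integral_norm_sub_le hK hIm (θ₀ := θ₀) ht ht1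
  have hc0 : 0 ≤ c.re := ge_of_tendsto' ((Complex.continuous_re.tendsto _).comp hac) fun n =>
    hre n a (by simpa using ha.le)
  set I := Set.Ioo (θ₀ - Real.pi * t) (θ₀ + Real.pi * t) with hI
  have hfin : volume I ≠ ⊤ := by rw [hI]; simp
  have hvol : volume.real I = 2 * Real.pi * t := by
    rw [hI, Real.volume_real_Ioo_of_le (by nlinarith [Real.pi_pos])]
    ring
  have hgI := integrableOn_comp_circlePt_of_Ioc hgi (θ₀ - Real.pi * t) (θ₀ + Real.pi * t)
  have hfI := integrableOn_comp_circlePt_of_Ioc h.integrable (θ₀ - Real.pi * t)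
    (θ₀ + Real.pi * t)
  have hfc := (hfI.sub (integrableOn_const (C := c) hfin)).norm
  refine meanOsc_le_of_integral_norm_sub_le ht hgI (Complex.exp (-c) * Y (circlePt θ₀)) ?_
  have hpt : ∀ᵐ θ ∂(volume.restrict I),
      ‖g (circlePt θ) - Complex.exp (-c) * Y (circlePt θ₀)‖ ≤
        ‖f (circlePt θ) - c‖ + (s + ε) := by
    have h1 := ae_circlePt_of_ae_restrict
      (p := fun z => ‖g z - Complex.exp (-f z) * Y z‖ ≤ s) hg
    filter_upwards [ae_restrict_of_ae h1, ae_restrict_mem measurableSet_Ioo] with θ hθ hθI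
    have h2 : ‖(Complex.exp (-f (circlePt θ)) - Complex.exp (-c)) * Y (circlePt θ)‖ ≤
        ‖f (circlePt θ) - c‖ := by
      rw [norm_mul]
      exact (mul_le_of_le_one_right (norm_nonneg _) (hY1 θ)).trans
        (norm_exp_neg_sub_exp_neg_le (hf θ) hc0)
    have h3 : ‖Complex.exp (-c) * (Y (circlePt θ) - Y (circlePt θ₀))‖ ≤ ε := by
      rw [norm_mul]
      refine (mul_le_of_le_one_left (norm_nonneg _) (norm_exp_neg_le_one hc0)).trans ?_
      have h4 := hYη _ (circlePt_mem_closedBall θ) _ (circlePt_mem_closedBall θ₀) ?_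
      · rw [dist_eq_norm] at h4; exact h4.le
      · rw [dist_eq_norm]
        refine (norm_circlePt_sub_le θ θ₀).trans_lt (lt_of_le_of_lt ?_ htη)
        rw [abs_le]
        constructor <;> linarith [hθI.1, hθI.2]
    have h5 : g (circlePt θ) - Complex.exp (-c) * Y (circlePt θ₀) =
        (g (circlePt θ) - Complex.exp (-f (circlePt θ)) * Y (circlePt θ)) +
        (Complex.exp (-f (circlePt θ)) - Complex.exp (-c)) * Y (circlePt θ) +
        Complex.exp (-c) * (Y (circlePt θ) - Y (circlePt θ₀)) := by ring
    rw [h5]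
    refine (norm_add₃_le).trans ?_
    linarith
  have h6 : ∫ θ in I, ‖g (circlePt θ) - Complex.exp (-c) * Y (circlePt θ₀)‖ ≤
      ∫ θ in I, (‖f (circlePt θ) - c‖ + (s + ε)) :=
    integral_mono_ae (hgI.sub (integrableOn_const hfin)).norm
      (hfc.add (integrableOn_const (C := s + ε) hfin)) hpt
  refine h6.trans ?_
  have h7 : ∫ θ in I, (‖f (circlePt θ) - c‖ + (s + ε)) =
      (∫ θ in I, ‖f (circlePt θ) - c‖) + ∫ _ in I, (s + ε) :=
    integral_add hfc (integrableOn_const hfin)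
  rw [h7]
  simp only [integral_const, measureReal_restrict_apply_univ, hvol, smul_eq_mul]
  linarith

end OuterFunctions

/-- The scale at which the `n`-th function of the construction is tested. -/
def scale (n : ℕ) : ℝ := Real.exp (-(n * 2 ^ n)) * (1 / 2) ^ (n + 1)

lemma scale_pos (n : ℕ) : 0 < scale n := by unfold scale; positivity

lemma scale_le (n : ℕ) : scale n ≤ (1 / 2) ^ (n + 1) := by
  unfold scale
  refine mul_le_of_le_one_left (by positivity) (Real.exp_le_one_iff.2 ?_)
  have : (0 : ℝ) ≤ n * 2 ^ n := by positivity
  linarith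

lemma hasSum_half_pow_succ : HasSum (fun n : ℕ => (1 / 2 : ℝ) ^ (n + 1)) 1 := by
  have h := hasSum_geometric_two.mul_right (1 / 2 : ℝ)
  norm_num at h
  norm_num [pow_succ]
  exact h

lemma summable_scale : Summable scale :=
  Summable.of_nonneg_of_le (fun n => (scale_pos n).le) scale_le hasSum_half_pow_succ.summable

lemma one_le_norm_one_add {x : ℂ} (hx : 0 ≤ x.re) : 1 ≤ ‖1 + x‖ := by
  have := Complex.re_le_norm (1 + x)
  simp at this
  linarith

lemma norm_le_norm_one_add {x : ℂ} (hx : 0 ≤ x.re) : ‖x‖ ≤ ‖1 + x‖ := by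
  refine (sq_le_sq₀ (norm_nonneg _) (norm_nonneg _)).1 ?_
  rw [← Complex.normSq_eq_norm_sq, ← Complex.normSq_eq_norm_sq, Complex.normSq_apply,
    Complex.normSq_apply]
  simp only [Complex.add_re, Complex.one_re, Complex.add_im, Complex.one_im, zero_add]
  nlinarith

lemma one_add_mem_slitPlane {x : ℂ} (hx : 0 ≤ x.re) : 1 + x ∈ Complex.slitPlane := by
  left; simp; linarith

lemma one_add_ne_zero_of_re_nonneg {x : ℂ} (hx : 0 ≤ x.re) : 1 + x ≠ 0 :=
  Complex.slitPlane_ne_zero (one_add_mem_slitPlane hx)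

lemma log_one_add_re_nonneg {x : ℂ} (hx : 0 ≤ x.re) : 0 ≤ (Complex.log (1 + x)).re := by
  rw [Complex.log_re]; exact Real.log_nonneg (one_le_norm_one_add hx)

lemma abs_log_one_add_im_le {x : ℂ} (hx : 0 ≤ x.re) : |(Complex.log (1 + x)).im| ≤ 2 := by
  rw [Complex.log_im]
  have h := Complex.abs_arg_le_pi_div_two_iff.2 (show 0 ≤ (1 + x).re by simp; linarith)
  linarith [Real.pi_le_four]

lemma norm_log_one_add_le {x : ℂ} (hx : 0 ≤ x.re) :
    ‖Complex.log (1 + x)‖ ≤ Real.log ‖1 + x‖ + 2 := by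
  refine (Complex.norm_le_abs_re_add_abs_im _).trans ?_
  rw [abs_of_nonneg (log_one_add_re_nonneg hx), Complex.log_re]
  linarith [abs_log_one_add_im_le hx]

/-! Pointwise estimates for a sequence `a` with nonnegative real parts. -/

section Pointwise

variable (a : ℕ → ℂ)

/-- The logarithmic size of `a n` at scale `scale n`. -/
def logSize (n : ℕ) : ℝ := Real.log ‖1 + a n / scale n‖

/-- The `n`-th term of the logarithm of the outer function. -/
def logTerm (n : ℕ) : ℂ := ((1 / 2 : ℝ) ^ n : ℝ) * Complex.log (1 + a n / scale n)

/-- Partial sums of the logarithm of the outer function. -/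
def logPartial (N : ℕ) : ℂ :=
  ∑ n ∈ Finset.range N, logTerm a n + 2 * Complex.log (1 + ∑ n ∈ Finset.range N, a n)

/-- The limit of `logPartial`. -/
def logTotal : ℂ := ∑' n, logTerm a n + 2 * Complex.log (1 + ∑' n, a n)

variable {a} (ha : ∀ n, 0 ≤ (a n).re)

include ha

lemma div_scale_re_nonneg (n : ℕ) : 0 ≤ (a n / scale n).re := by
  rw [Complex.div_ofReal_re]; exact div_nonneg (ha n) (scale_pos n).le

lemma logSize_nonneg (n : ℕ) : 0 ≤ logSize a n :=
  Real.log_nonneg (one_le_norm_one_add (div_scale_re_nonneg ha n))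

omit ha in
lemma logTerm_re (n : ℕ) : (logTerm a n).re = (1 / 2) ^ n * logSize a n := by
  unfold logTerm logSize
  rw [Complex.re_ofReal_mul, Complex.log_re]

lemma logTerm_re_nonneg (n : ℕ) : 0 ≤ (logTerm a n).re := by
  rw [logTerm_re]; exact mul_nonneg (by positivity) (logSize_nonneg ha n)

lemma abs_logTerm_im_le (n : ℕ) : |(logTerm a n).im| ≤ 2 * (1 / 2) ^ n := by
  unfold logTerm
  rw [Complex.im_ofReal_mul, abs_mul, abs_of_nonneg (by positivity), mul_comm]
  gcongr
  exact abs_log_one_add_im_le (div_scale_re_nonneg ha n)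

lemma norm_logTerm_le (n : ℕ) : ‖logTerm a n‖ ≤ logSize a n + 2 * (1 / 2) ^ n := by
  refine (Complex.norm_le_abs_re_add_abs_im _).trans (add_le_add ?_ (abs_logTerm_im_le ha n))
  rw [abs_of_nonneg (logTerm_re_nonneg ha n), logTerm_re]
  exact mul_le_of_le_one_left (logSize_nonneg ha n) (pow_le_one₀ (by norm_num) (by norm_num))

lemma log_one_add_norm_le (n : ℕ) : Real.log (1 + ‖a n‖) ≤ scale n + logSize a n := by
  have hs := scale_pos n
  set x := a n / scale n with hx
  have hx0 := div_scale_re_nonneg ha n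
  have h1 := one_le_norm_one_add hx0
  have h2 := norm_le_norm_one_add hx0
  have h3 : ‖a n‖ = scale n * ‖x‖ := by
    rw [hx, norm_div, Complex.norm_real, Real.norm_of_nonneg hs.le]; field_simp
  have h4 : 1 + ‖a n‖ ≤ (1 + scale n) * ‖1 + x‖ := by
    rw [h3]; nlinarith
  calc Real.log (1 + ‖a n‖) ≤ Real.log ((1 + scale n) * ‖1 + x‖) :=
        Real.log_le_log (by positivity) h4
    _ = Real.log (1 + scale n) + Real.log ‖1 + x‖ := Real.log_mul (by positivity) (by positivity)
    _ ≤ scale n + logSize a n := by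
        have := Real.log_le_sub_one_of_pos (show 0 < 1 + scale n by linarith)
        unfold logSize
        linarith

lemma logSize_ge_of_norm_gt {n : ℕ} (h : (1 / 2 : ℝ) ^ n < ‖a n‖) :
    n ≤ (1 / 2) ^ n * logSize a n := by
  have hs := scale_pos n
  have h1 : Real.exp (n * 2 ^ n) ≤ ‖1 + a n / scale n‖ := by
    refine le_trans ?_ (norm_le_norm_one_add (div_scale_re_nonneg ha n))
    rw [norm_div, Complex.norm_real, Real.norm_of_nonneg hs.le, le_div_iff₀ hs, scale,
      ← mul_assoc, ← Real.exp_add, add_neg_cancel, Real.exp_zero, one_mul]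
    refine le_trans ?_ h.le
    rw [pow_succ]
    exact mul_le_of_le_one_right (by positivity) (by norm_num)
  have h2 : n * 2 ^ n ≤ logSize a n := (Real.le_log_iff_exp_le ((Real.exp_pos _).trans_le h1)).2 h1
  calc (n : ℝ) = (1 / 2) ^ n * (n * 2 ^ n) := by
        rw [mul_left_comm, ← mul_pow]; norm_num
    _ ≤ _ := by gcongr

lemma logPartial_re_nonneg (N : ℕ) : 0 ≤ (logPartial a N).re := by
  unfold logPartial
  have h1 : 0 ≤ (∑ n ∈ Finset.range N, a n).re := by
    rw [Complex.re_sum]; exact Finset.sum_nonneg fun n _ => ha n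
  have h2 : 0 ≤ (∑ n ∈ Finset.range N, logTerm a n).re := by
    rw [Complex.re_sum]; exact Finset.sum_nonneg fun n _ => logTerm_re_nonneg ha n
  have h3 := log_one_add_re_nonneg h1
  simp only [Complex.add_re, Complex.mul_re, Complex.re_ofNat, Complex.im_ofNat, zero_mul, sub_zero]
  linarith

lemma sum_shift_logTerm_re_nonneg (N M : ℕ) :
    0 ≤ (∑ n ∈ Finset.range M, logTerm a (n + N)).re := by
  rw [Complex.re_sum]; exact Finset.sum_nonneg fun n _ => logTerm_re_nonneg ha _

lemma abs_sum_shift_logTerm_im_le (N M : ℕ) :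
    |(∑ n ∈ Finset.range M, logTerm a (n + N)).im| ≤ 4 * (1 / 2) ^ N := by
  rw [Complex.im_sum]
  refine (Finset.abs_sum_le_sum_abs _ _).trans ?_
  refine (Finset.sum_le_sum fun n _ => abs_logTerm_im_le ha (n + N)).trans ?_
  have h1 : ∑ n ∈ Finset.range M, 2 * (1 / 2 : ℝ) ^ (n + N) =
      2 * (1 / 2) ^ N * ∑ n ∈ Finset.range M, (1 / 2 : ℝ) ^ n := by
    rw [Finset.mul_sum]
    exact Finset.sum_congr rfl fun n _ => by rw [pow_add]; ring
  rw [h1]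
  have h2 : ∑ n ∈ Finset.range M, (1 / 2 : ℝ) ^ n ≤ 2 :=
    sum_le_hasSum _ (fun n _ => by positivity) hasSum_geometric_two
  nlinarith [show (0 : ℝ) < (1 / 2) ^ N by positivity]

lemma abs_logPartial_im_le (N : ℕ) : |(logPartial a N).im| ≤ 8 := by
  have h1 : 0 ≤ (∑ n ∈ Finset.range N, a n).re := by
    rw [Complex.re_sum]; exact Finset.sum_nonneg fun n _ => ha n
  have h2 := abs_sum_shift_logTerm_im_le ha 0 N
  have h3 := abs_log_one_add_im_le h1
  simp only [add_zero, pow_zero, mul_one] at h2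
  unfold logPartial
  simp only [Complex.add_im, Complex.mul_im, Complex.re_ofNat, Complex.im_ofNat, zero_mul, add_zero]
  refine (abs_add_le _ _).trans ?_
  rw [abs_mul, abs_two]
  linarith

lemma norm_exp_neg_logPartial_le (N : ℕ) :
    ‖Complex.exp (-logPartial a N)‖ ≤ ((1 + ∑ n ∈ Finset.range N, (a n).re) ^ 2)⁻¹ := by
  have h1 : 0 ≤ (∑ n ∈ Finset.range N, a n).re := by
    rw [Complex.re_sum]; exact Finset.sum_nonneg fun n _ => ha n
  have h2 : 0 ≤ (∑ n ∈ Finset.range N, logTerm a n).re := by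
    rw [Complex.re_sum]; exact Finset.sum_nonneg fun n _ => logTerm_re_nonneg ha n
  have h4 : 1 + ∑ n ∈ Finset.range N, (a n).re ≤ ‖1 + ∑ n ∈ Finset.range N, a n‖ := by
    have := Complex.re_le_norm (1 + ∑ n ∈ Finset.range N, a n)
    simpa using this
  rw [Complex.re_sum] at h1
  rw [Complex.norm_exp]
  have h3 : (-logPartial a N).re ≤ -(2 * Real.log (1 + ∑ n ∈ Finset.range N, (a n).re)) := by
    unfold logPartial
    simp only [Complex.neg_re, Complex.add_re, Complex.mul_re, Complex.re_ofNat, Complex.im_ofNat,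
      zero_mul, sub_zero, Complex.log_re]
    have := Real.log_le_log (by linarith) h4
    linarith
  refine (Real.exp_le_exp.2 h3).trans_eq ?_
  rw [Real.exp_neg, two_mul, Real.exp_add, Real.exp_log (by linarith), sq]

variable (hs : Summable (logSize a))

include hs

lemma summable_norm_of_summable_logSize : Summable fun n => ‖a n‖ := by
  have h1 : ∀ᶠ n in atTop, logSize a n ≤ 1 :=
    (hs.tendsto_atTop_zero.eventually_lt_const one_pos).mono fun n hn => hn.le
  refine Summable.of_norm_bounded_eventually_nat (g := fun n => 3 * scale n)
    (summable_scale.mul_left 3) ?_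
  filter_upwards [h1] with n hn
  have hsp := scale_pos n
  have hx0 := div_scale_re_nonneg ha n
  have h2 : ‖1 + a n / scale n‖ ≤ Real.exp 1 :=
    (Real.log_le_iff_le_exp (by linarith [one_le_norm_one_add hx0])).1 hn
  have h3 := (norm_le_norm_one_add hx0).trans (h2.trans Real.exp_one_lt_three.le)
  rw [norm_div, Complex.norm_real, Real.norm_of_nonneg hsp.le, div_le_iff₀ hsp] at h3
  rwa [norm_norm]

lemma summable_norm_logTerm : Summable fun n => ‖logTerm a n‖ :=
  Summable.of_nonneg_of_le (fun _ => norm_nonneg _) (norm_logTerm_le ha)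
    (hs.add (summable_geometric_two.mul_left 2))

lemma sum_norm_shift_logTerm_le (N M : ℕ) :
    ‖∑ n ∈ Finset.range M, logTerm a (n + N)‖ ≤ ∑' n, logSize a n + 4 := by
  refine (norm_sum_le _ _).trans ?_
  have h1 : HasSum (fun n => logSize a n + 2 * (1 / 2 : ℝ) ^ n) (∑' n, logSize a n + 4) := by
    have := hs.hasSum.add (hasSum_geometric_two.mul_left 2)
    norm_num at this ⊢
    exact this
  have h2 := sum_le_hasSum ((Finset.range M).map ⟨fun n => n + N, add_left_injective N⟩)
    (fun n _ => add_nonneg (logSize_nonneg ha n) (by positivity)) h1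
  rw [Finset.sum_map] at h2
  exact (Finset.sum_le_sum fun n _ => norm_logTerm_le ha (n + N)).trans h2

omit hs in
lemma log_one_add_sum_norm_le (N : ℕ) :
    Real.log (1 + ∑ n ∈ Finset.range N, ‖a n‖) ≤
      ∑ n ∈ Finset.range N, (scale n + logSize a n) := by
  induction N with
  | zero => simp
  | succ N ih =>
    rw [Finset.sum_range_succ, Finset.sum_range_succ]
    have hS : 0 ≤ ∑ n ∈ Finset.range N, ‖a n‖ := Finset.sum_nonneg fun _ _ => norm_nonneg _
    have h0 := norm_nonneg (a N)
    calc Real.log (1 + (∑ n ∈ Finset.range N, ‖a n‖ + ‖a N‖))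
        ≤ Real.log ((1 + ∑ n ∈ Finset.range N, ‖a n‖) * (1 + ‖a N‖)) :=
          Real.log_le_log (by positivity) (by nlinarith)
      _ = Real.log (1 + ∑ n ∈ Finset.range N, ‖a n‖) + Real.log (1 + ‖a N‖) :=
          Real.log_mul (by positivity) (by positivity)
      _ ≤ _ := add_le_add ih (log_one_add_norm_le ha N)

lemma norm_logPartial_le (N : ℕ) : ‖logPartial a N‖ ≤ 3 * ∑' n, logSize a n + 10 := by
  have h1 : 0 ≤ (∑ n ∈ Finset.range N, a n).re := by
    rw [Complex.re_sum]; exact Finset.sum_nonneg fun n _ => ha n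
  have h2 := sum_norm_shift_logTerm_le ha hs 0 N
  simp only [add_zero] at h2
  have h3 := norm_log_one_add_le h1
  have h4 : Real.log ‖1 + ∑ n ∈ Finset.range N, a n‖ ≤ ∑' n, logSize a n + 1 := by
    calc _ ≤ Real.log (1 + ∑ n ∈ Finset.range N, ‖a n‖) := by
          refine Real.log_le_log (by linarith [one_le_norm_one_add h1]) ?_
          refine (norm_add_le _ _).trans ?_
          rw [norm_one]
          gcongr
          exact norm_sum_le _ _
      _ ≤ ∑ n ∈ Finset.range N, (scale n + logSize a n) := log_one_add_sum_norm_le ha N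
      _ ≤ ∑ n ∈ Finset.range N, ((1 / 2) ^ (n + 1) + logSize a n) := by
          gcongr with n _
          exact scale_le n
      _ ≤ 1 + ∑' n, logSize a n := sum_le_hasSum _
          (fun n _ => add_nonneg (by positivity) (logSize_nonneg ha n))
          (hasSum_half_pow_succ.add hs.hasSum)
      _ = _ := add_comm _ _
  unfold logPartial
  refine (norm_add_le _ _).trans ?_
  rw [norm_mul, Complex.norm_ofNat]
  linarith

omit hs in
lemma tsum_re_nonneg : 0 ≤ (∑' n, a n).re := by
  by_cases h : Summable a
  · rw [Complex.re_tsum h]; exact tsum_nonneg ha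
  · rw [tsum_eq_zero_of_not_summable h, Complex.zero_re]

omit hs in
lemma logTotal_re_nonneg : 0 ≤ (logTotal a).re := by
  unfold logTotal
  have h1 := tsum_re_nonneg (a := logTerm a) (logTerm_re_nonneg ha)
  have h2 := log_one_add_re_nonneg (tsum_re_nonneg ha)
  simp only [Complex.add_re, Complex.mul_re, Complex.re_ofNat, Complex.im_ofNat, zero_mul, sub_zero]
  linarith

lemma tendsto_logPartial : Tendsto (logPartial a) atTop (𝓝 (logTotal a)) := by
  have h1 := (summable_norm_logTerm ha hs).of_norm.hasSum.tendsto_sum_nat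
  have h2 := (summable_norm_of_summable_logSize ha hs).of_norm.hasSum.tendsto_sum_nat
  have h3 := (h2.const_add 1).clog (one_add_mem_slitPlane (tsum_re_nonneg ha))
  exact h1.add (h3.const_mul 2)

lemma norm_exp_neg_logTotal_sub_le (N : ℕ) :
    ‖Complex.exp (-logTotal a) -
      Complex.exp (-∑' n, logTerm a (n + N)) * Complex.exp (-logPartial a N)‖ ≤
      4 * (1 / 2) ^ N := by
  have hsT := (summable_norm_logTerm ha hs).of_norm
  have hsa := (summable_norm_of_summable_logSize ha hs)
  set b : ℂ := 1 + ∑' n, a n with hb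
  set c : ℂ := 1 + ∑ n ∈ Finset.range N, a n with hc
  have hcre : 0 ≤ (∑ n ∈ Finset.range N, a n).re := by
    rw [Complex.re_sum]; exact Finset.sum_nonneg fun n _ => ha n
  have hb1 : 1 ≤ ‖b‖ := one_le_norm_one_add (tsum_re_nonneg ha)
  have hc1 : 1 ≤ ‖c‖ := one_le_norm_one_add hcre
  have hb0 : b ≠ 0 := one_add_ne_zero_of_re_nonneg (tsum_re_nonneg ha)
  have hc0 : c ≠ 0 := one_add_ne_zero_of_re_nonneg hcre
  have hexp : ∀ {w : ℂ}, w ≠ 0 → Complex.exp (-(2 * Complex.log w)) = (w⁻¹) ^ 2 := by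
    intro w hw
    rw [Complex.exp_neg, two_mul, Complex.exp_add, Complex.exp_log hw, inv_pow, sq]
  have h1 : Complex.exp (-logTotal a) -
      Complex.exp (-∑' n, logTerm a (n + N)) * Complex.exp (-logPartial a N) =
      Complex.exp (-∑' n, logTerm a n) * ((b⁻¹) ^ 2 - (c⁻¹) ^ 2) := by
    rw [← Complex.exp_add]
    have h2 : -∑' n, logTerm a (n + N) + -logPartial a N =
        -∑' n, logTerm a n + -(2 * Complex.log c) := by
      rw [← hsT.sum_add_tsum_nat_add N, logPartial]; ring
    rw [h2, logTotal, neg_add, Complex.exp_add, Complex.exp_add, hexp hb0, hexp hc0, mul_sub]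
  rw [h1, norm_mul]
  have hbi : ‖b⁻¹‖ ≤ 1 := by rw [norm_inv]; exact inv_le_one_of_one_le₀ hb1
  have hci : ‖c⁻¹‖ ≤ 1 := by rw [norm_inv]; exact inv_le_one_of_one_le₀ hc1
  have hG0 : 0 ≤ (∑' n, logTerm a n).re :=
    tsum_re_nonneg (a := logTerm a) (logTerm_re_nonneg ha)
  by_cases hsmall : ∀ n, ‖a (n + N)‖ ≤ (1 / 2) ^ (n + N)
  · have h3 : ‖b - c‖ ≤ 2 * (1 / 2) ^ N := by
      have h4 : b - c = ∑' n, a (n + N) := by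
        rw [hb, hc, ← hsa.of_norm.sum_add_tsum_nat_add N]; ring
      rw [h4]
      refine tsum_of_norm_bounded (g := fun n => (1 / 2 : ℝ) ^ (n + N)) ?_ hsmall
      simp_rw [pow_add]
      exact hasSum_geometric_two.mul_right _
    have h5 : (b⁻¹) ^ 2 - (c⁻¹) ^ 2 = (b⁻¹ + c⁻¹) * (b⁻¹ * c⁻¹ * (c - b)) := by
      field_simp
      ring
    rw [h5, norm_mul, norm_mul, norm_mul, norm_sub_rev c b]
    have h6 : ‖b⁻¹ + c⁻¹‖ ≤ 2 := (norm_add_le _ _).trans (by linarith)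
    calc ‖Complex.exp (-∑' n, logTerm a n)‖ * (‖b⁻¹ + c⁻¹‖ * (‖b⁻¹‖ * ‖c⁻¹‖ * ‖b - c‖))
        ≤ 1 * (2 * (1 * 1 * (2 * (1 / 2) ^ N))) := by
          gcongr
          exact norm_exp_neg_le_one hG0
      _ = 4 * (1 / 2) ^ N := by ring
  · push Not at hsmall
    obtain ⟨n, hn⟩ := hsmall
    have h2 := logSize_ge_of_norm_gt ha hn
    have h3 : (N : ℝ) ≤ (∑' n, logTerm a n).re := by
      rw [Complex.re_tsum hsT]
      refine le_trans ?_ ((Complex.hasSum_re hsT.hasSum).summable.le_tsum (n + N)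
        fun m _ => logTerm_re_nonneg ha m)
      rw [logTerm_re]
      refine le_trans ?_ h2
      push_cast
      linarith [(Nat.cast_nonneg n : (0 : ℝ) ≤ n)]
    have h4 : ‖Complex.exp (-∑' n, logTerm a n)‖ ≤ (1 / 2) ^ N := by
      rw [Complex.norm_exp, Complex.neg_re]
      calc Real.exp (-(∑' n, logTerm a n).re) ≤ Real.exp (-N) := Real.exp_le_exp.2 (by linarith)
        _ = (Real.exp (-1)) ^ N := by rw [← Real.exp_nat_mul]; ring_nf
        _ ≤ (1 / 2) ^ N := by
          gcongr
          rw [Real.exp_neg, one_div]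
          gcongr
          linarith [Real.exp_one_gt_d9]
    have h5 : ‖(b⁻¹) ^ 2 - (c⁻¹) ^ 2‖ ≤ 2 := by
      refine (norm_sub_le _ _).trans ?_
      rw [norm_pow, norm_pow]
      have h6 := pow_le_one₀ (n := 2) (norm_nonneg _) hbi
      have h7 := pow_le_one₀ (n := 2) (norm_nonneg _) hci
      linarith
    calc _ ≤ (1 / 2 : ℝ) ^ N * 2 := by gcongr
      _ ≤ _ := by linarith [show (0 : ℝ) < (1 / 2) ^ N by positivity]

end Pointwise

lemma integrable_tsum_of_nonneg {α : Type*} [MeasurableSpace α] {μ : Measure α} {F : ℕ → α → ℝ}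
    (hF : ∀ n, Integrable (F n) μ) (h0 : ∀ n x, 0 ≤ F n x)
    (hs : Summable fun n => ∫ x, F n x ∂μ) :
    Integrable (fun x => ∑' n, F n x) μ ∧ ∀ᵐ x ∂μ, Summable fun n => F n x := by
  have hm : ∀ n, AEMeasurable (fun x => ENNReal.ofReal (F n x)) μ := fun n =>
    (hF n).1.aemeasurable.ennreal_ofReal
  have hfin : ∫⁻ x, ∑' n, ENNReal.ofReal (F n x) ∂μ ≠ ⊤ := by
    rw [lintegral_tsum hm]
    simp_rw [fun n => (ofReal_integral_eq_lintegral_ofReal (hF n)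
      (Eventually.of_forall (h0 n))).symm]
    exact hs.tsum_ofReal_ne_top
  constructor
  · have h1 := integrable_toReal_of_lintegral_ne_top (AEMeasurable.tsum hm) hfin
    refine h1.congr (Eventually.of_forall fun x => ?_)
    simp only
    rw [ENNReal.tsum_toReal_eq fun n => ENNReal.ofReal_ne_top]
    exact tsum_congr fun n => ENNReal.toReal_ofReal (h0 n x)
  · filter_upwards [ae_lt_top' (AEMeasurable.tsum hm) hfin] with x hx
    exact (ENNReal.summable_toReal hx.ne).congr fun n => ENNReal.toReal_ofReal (h0 n x)

lemma DiffContOnCl.clog_one_add {g : ℂ → ℂ} (hg : DiffContOnCl ℂ g (Metric.ball 0 1))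
    (hre : ∀ z ∈ Metric.closedBall (0 : ℂ) 1, 0 ≤ (g z).re) :
    DiffContOnCl ℂ (fun z => Complex.log (1 + g z)) (Metric.ball 0 1) where
  differentiableOn := (hg.differentiableOn.const_add 1).clog fun z hz =>
    one_add_mem_slitPlane (hre z (Metric.ball_subset_closedBall hz))
  continuousOn := (continuousOn_const.add hg.continuousOn).clog fun z hz =>
    one_add_mem_slitPlane (hre z (Metric.closure_ball_subset_closedBall hz))

lemma DiffContOnCl.finset_sum {ι : Type*} {g : ι → ℂ → ℂ} (s : Finset ι)
    (hg : ∀ i, DiffContOnCl ℂ (g i) (Metric.ball 0 1)) :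
    DiffContOnCl ℂ (fun z => ∑ i ∈ s, g i z) (Metric.ball 0 1) where
  differentiableOn := DifferentiableOn.fun_sum fun i _ => (hg i).differentiableOn
  continuousOn := continuousOn_finsetSum s fun i _ => (hg i).continuousOn

section Construction

variable {f : ℕ → ℂ → ℂ} (hf : ∀ n, DiffContOnCl ℂ (f n) (Metric.ball 0 1))
  (hre : ∀ n, ∀ z ∈ Metric.closedBall (0 : ℂ) 1, 0 ≤ (f n z).re)

include hf hre

lemma diffContOnCl_log_scale (n : ℕ) :
    DiffContOnCl ℂ (fun z => Complex.log (1 + f n z / scale n)) (Metric.ball 0 1) := by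
  refine DiffContOnCl.clog_one_add (g := fun z => f n z / scale n) ?_ fun z hz =>
    div_scale_re_nonneg (a := fun n => f n z) (fun n => hre n z hz) n
  simp_rw [div_eq_inv_mul]
  exact (hf n).const_smul ((scale n : ℂ)⁻¹)

lemma diffContOnCl_logTerm (n : ℕ) :
    DiffContOnCl ℂ (fun z => logTerm (fun n => f n z) n) (Metric.ball 0 1) :=
  (diffContOnCl_log_scale hf hre n).const_smul (((1 / 2 : ℝ) ^ n : ℝ) : ℂ)

lemma diffContOnCl_logPartial (N : ℕ) :
    DiffContOnCl ℂ (fun z => logPartial (fun n => f n z) N) (Metric.ball 0 1) := by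
  refine (DiffContOnCl.finset_sum _ fun n => diffContOnCl_logTerm hf hre n).add
    (DiffContOnCl.const_smul (DiffContOnCl.clog_one_add
      (DiffContOnCl.finset_sum _ hf) fun z hz => ?_) (2 : ℂ))
  rw [Complex.re_sum]
  exact Finset.sum_nonneg fun n _ => hre n z hz

variable (h0 : ∀ n, (f n 0).im = 0)
  (hsmall : ∀ n, 1 ≤ n → (f n 0).re ≤ scale n * (1 / 2) ^ n)

include h0 hsmall

lemma integrable_tsum_logSize :
    IntegrableOn (fun θ => ∑' n, logSize (fun n => f n (circlePt θ)) n)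
      (Set.Ioc 0 (2 * Real.pi)) ∧
    ∀ᵐ θ ∂(volume.restrict (Set.Ioc 0 (2 * Real.pi))),
      Summable (logSize fun n => f n (circlePt θ)) := by
  have hL := diffContOnCl_log_scale hf hre
  have hLc : ∀ n, Continuous fun θ => Complex.log (1 + f n (circlePt θ) / scale n) := fun n =>
    (hL n).continuousOn_unitClosedBall.comp_continuous continuous_circlePt
      circlePt_mem_closedBall
  have hsz : ∀ n θ, logSize (fun n => f n (circlePt θ)) n =
      (Complex.log (1 + f n (circlePt θ) / scale n)).re := fun n θ => (Complex.log_re _).symm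
  have hint : ∀ n, ∫ θ in Set.Ioc 0 (2 * Real.pi), logSize (fun n => f n (circlePt θ)) n =
      2 * Real.pi * (Complex.log (1 + f n 0 / scale n)).re := by
    intro n
    have h1 := setIntegral_diskPoisson_smul (hL n) (a := 0) (by simp)
    have h2 : ∀ θ, diskPoisson 0 θ = 1 := fun θ => by simp [diskPoisson, norm_circlePt]
    simp only [h2, Complex.ofReal_one, one_mul] at h1
    have h3 := integral_re (𝕜 := ℂ) ((hLc n).integrableOn_Ioc (μ := volume)
      (a := 0) (b := 2 * Real.pi))
    simp only [RCLike.re_eq_complex_re] at h3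
    simp_rw [hsz]
    rw [h3, h1, Complex.re_ofReal_mul]
  refine integrable_tsum_of_nonneg (fun n => ?_)
    (fun n θ => logSize_nonneg (fun n => hre n _ (circlePt_mem_closedBall θ)) n) ?_
  · simp_rw [hsz]
    exact (Complex.continuous_re.comp (hLc n)).integrableOn_Ioc
  · simp_rw [hint]
    refine Summable.mul_left _ ((summable_nat_add_iff 1).1 ?_)
    have hz : (0 : ℂ) ∈ Metric.closedBall (0 : ℂ) 1 := by simp
    have hd := fun n => div_scale_re_nonneg (a := fun n => f n 0) (fun n => hre n 0 hz) n
    refine Summable.of_nonneg_of_le (fun n => log_one_add_re_nonneg (hd _)) (fun n => ?_)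
      ((summable_nat_add_iff 1).2 summable_geometric_two)
    have hreal : f (n + 1) 0 / scale (n + 1) = (((f (n + 1) 0).re / scale (n + 1) : ℝ) : ℂ) := by
      rw [Complex.ofReal_div]
      congr 1
      exact Complex.ext (by simp) (by simp [h0])
    have hd1 := hd (n + 1)
    rw [hreal, Complex.ofReal_re] at hd1
    rw [Complex.log_re, hreal, ← Complex.ofReal_one, ← Complex.ofReal_add, Complex.norm_real,
      Real.norm_of_nonneg (by linarith)]
    have h4 := Real.log_le_sub_one_of_pos
      (show 0 < 1 + (f (n + 1) 0).re / scale (n + 1) by linarith)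
    have h5 : (f (n + 1) 0).re / scale (n + 1) ≤ (1 / 2) ^ (n + 1) := by
      rw [div_le_iff₀' (scale_pos _)]
      exact hsmall _ (by omega)
    linarith

lemma isBoundaryLimit_logPartial :
    IsBoundaryLimit (fun N z => logPartial (fun n => f n z) N)
      (fun z => 3 * ∑' n, logSize (fun n => f n z) n + 10) (fun z => logTotal fun n => f n z) := by
  obtain ⟨hi, hs⟩ := integrable_tsum_logSize hf hre h0 hsmall
  refine ⟨diffContOnCl_logPartial hf hre,
    (hi.const_mul 3).add (integrableOn_const measure_Ioc_lt_top.ne), ?_, ?_⟩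
  · filter_upwards [hs] with θ hθ
    exact norm_logPartial_le (fun n => hre n _ (circlePt_mem_closedBall θ)) hθ
  · filter_upwards [hs] with θ hθ
    exact tendsto_logPartial (fun n => hre n _ (circlePt_mem_closedBall θ)) hθ

lemma isBoundaryLimit_shift_logTerm (N : ℕ) :
    IsBoundaryLimit (fun M z => ∑ n ∈ Finset.range M, logTerm (fun n => f n z) (n + N))
      (fun z => ∑' n, logSize (fun n => f n z) n + 4)
      (fun z => ∑' n, logTerm (fun n => f n z) (n + N)) := by
  obtain ⟨hi, hs⟩ := integrable_tsum_logSize hf hre h0 hsmall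
  refine ⟨fun M => DiffContOnCl.finset_sum _ fun n => diffContOnCl_logTerm hf hre (n + N),
    hi.add (integrableOn_const measure_Ioc_lt_top.ne), ?_, ?_⟩
  · filter_upwards [hs] with θ hθ
    exact sum_norm_shift_logTerm_le (fun n => hre n _ (circlePt_mem_closedBall θ)) hθ N
  · filter_upwards [hs] with θ hθ
    exact ((summable_nat_add_iff N).2 (summable_norm_logTerm
      (fun n => hre n _ (circlePt_mem_closedBall θ)) hθ).of_norm).hasSum.tendsto_sum_nat

lemma isVMO_exp_neg_logTotal :
    IsVMO fun θ => Complex.exp (-logTotal fun n => f n (circlePt θ)) := by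
  have hH := isBoundaryLimit_logPartial hf hre h0 hsmall
  have hHre : ∀ N, ∀ z ∈ Metric.closedBall (0 : ℂ) 1, 0 ≤ (logPartial (fun n => f n z) N).re :=
    fun N z hz => logPartial_re_nonneg (fun n => hre n z hz) N
  have hc := fun θ n => hre n _ (circlePt_mem_closedBall θ)
  have hE := hH.exp_neg hHre
  have hE1 : ∀ θ, ‖Complex.exp (-logTotal fun n => f n (circlePt θ))‖ ≤ 1 := fun θ =>
    norm_exp_neg_le_one (logTotal_re_nonneg (hc θ))
  refine ⟨⟨fun θ => by simp only [circlePt_periodic θ], hE.integrable, 2 * 1, ?_⟩, ?_⟩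
  · intro θ₀ t ht _
    have hI := integrableOn_comp_circlePt_of_Ioc
      (f := fun z => Complex.exp (-logTotal fun n => f n z)) hE.integrable (θ₀ - Real.pi * t)
      (θ₀ + Real.pi * t)
    refine meanOsc_le_of_integral_norm_sub_le ht hI 0 ?_
    have h1 := setIntegral_mono_on (μ := volume) hI.norm
      (integrableOn_const (C := (1 : ℝ)) measure_Ioo_lt_top.ne)
      measurableSet_Ioo fun θ _ => hE1 θ
    simp only [sub_zero]
    refine h1.trans_eq ?_
    rw [setIntegral_const, Real.volume_real_Ioo_of_le (by nlinarith [Real.pi_pos]), smul_eq_mul]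
    ring
  · intro ε hε
    obtain ⟨N, hN⟩ := exists_pow_lt_of_lt_one (show 0 < ε / 2336 by positivity)
      (show (1 / 2 : ℝ) < 1 by norm_num)
    have hN0 : (0 : ℝ) < (1 / 2) ^ N := by positivity
    obtain ⟨δ, hδ, h⟩ := (isBoundaryLimit_shift_logTerm hf hre h0 hsmall N).exists_meanOsc_le
      (K := 4 * (1 / 2) ^ N) (by positivity)
      (fun M z hz => sum_shift_logTerm_re_nonneg (fun n => hre n z hz) N M)
      (fun M z hz => abs_sum_shift_logTerm_im_le (fun n => hre n z hz) N M)
      (fun θ => tsum_re_nonneg fun n => logTerm_re_nonneg (hc θ) (n + N))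
      (Y := fun z => Complex.exp (-logPartial (fun n => f n z) N))
      (hE.diffContOnCl N).continuousOn_unitClosedBall
      (fun θ => norm_exp_neg_le_one (hHre N _ (circlePt_mem_closedBall θ)))
      (g := fun z => Complex.exp (-logTotal fun n => f n z)) (s := 4 * (1 / 2) ^ N)
      hE.integrable (by
        filter_upwards [(integrable_tsum_logSize hf hre h0 hsmall).2] with θ hθ
        exact norm_exp_neg_logTotal_sub_le (hc θ) hθ N)
      (ε := ε / 4) (by positivity)
    refine ⟨δ, hδ, fun θ₀ t ht htδ => (h θ₀ t ht htδ).trans ?_⟩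
    linarith

/-- The outer function attached to a sequence of analytic functions with nonnegative real part
which are small at the origin. -/
theorem exists_outer_le_inv_sq :
    ∃ (E : ℂ → ℂ) (Eb : ℝ → ℂ), IsOuter E ∧ MemQA E Eb ∧
      IsBMO (fun θ => ((Real.log ‖Eb θ‖ : ℝ) : ℂ)) ∧
      ∀ z, ‖z‖ < 1 → ∀ N, ‖E z‖ ≤ ((1 + ∑ n ∈ Finset.range N, (f n z).re) ^ 2)⁻¹ := by
  have hH := isBoundaryLimit_logPartial hf hre h0 hsmall
  have hHre : ∀ N, ∀ z ∈ Metric.closedBall (0 : ℂ) 1, 0 ≤ (logPartial (fun n => f n z) N).re :=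
    fun N z hz => logPartial_re_nonneg (fun n => hre n z hz) N
  have hc := fun θ n => hre n _ (circlePt_mem_closedBall θ)
  have hH0 : ∀ N, (logPartial (fun n => f n 0) N).im = 0 := by
    intro N
    have h1 : ∀ x : ℂ, 0 ≤ x.re → x.im = 0 → (Complex.log (1 + x)).im = 0 := fun x hx hx' => by
      rw [Complex.log_im, Complex.arg_eq_zero_iff]
      simp [hx', add_nonneg zero_le_one hx]
    have hz : (0 : ℂ) ∈ Metric.closedBall (0 : ℂ) 1 := by simp
    have h2 : ∀ n, (logTerm (fun n => f n 0) n).im = 0 := fun n => by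
      rw [logTerm, Complex.im_ofReal_mul,
        h1 _ (div_scale_re_nonneg (a := fun n => f n 0) (fun n => hre n 0 hz) n)
          (by simp [Complex.div_ofReal_im, h0]), mul_zero]
    rw [logPartial, Complex.add_im, Complex.im_sum, Finset.sum_eq_zero fun n _ => h2 n,
      Complex.mul_im, h1 _ (by rw [Complex.re_sum]; exact Finset.sum_nonneg fun n _ => hre n 0 hz)
        (by rw [Complex.im_sum]; exact Finset.sum_eq_zero fun n _ => h0 n)]
    simp
  refine ⟨outerExp fun ζ => -(logTotal fun n => f n ζ).re,
    fun θ => Complex.exp (-logTotal fun n => f n (circlePt θ)),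
    isOuter_outerExp hH.integrable.re.neg,
    ⟨hH.memHinf hH0 hHre, hH.hasRadialLimits hH0 hHre fun θ => logTotal_re_nonneg (hc θ),
      isVMO_exp_neg_logTotal hf hre h0 hsmall⟩,
    hH.isBMO_log_norm_exp_neg (K := 8) (by norm_num)
      fun N z hz => abs_logPartial_im_le (fun n => hre n z hz) N, ?_⟩
  intro z hz N
  have hz' : z ∈ Metric.closedBall (0 : ℂ) 1 := by simpa using hz.le
  refine hH.norm_outerExp_le hH0 hz ?_
  filter_upwards [eventually_ge_atTop N] with M hM
  refine (norm_exp_neg_logPartial_le (fun n => hre n z hz') M).trans ?_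
  have h1 : 0 ≤ ∑ n ∈ Finset.range N, (f n z).re := Finset.sum_nonneg fun n _ => hre n z hz'
  gcongr
  exact fun n _ _ => hre n z hz'

end Construction

section CauchyTransform

open scoped ENNReal ComplexConjugate

/-- The Cauchy transform of a measure on the disc. -/
def cauchyTransform (ν : Measure ℂ) (z : ℂ) : ℂ := ∫ w, 1 / (1 - conj w * z) ∂ν

lemma cauchyTransform_zero (ν : Measure ℂ) : cauchyTransform ν 0 = (ν.real univ : ℂ) := by
  simp [cauchyTransform]

lemma one_sub_mul_le_norm_one_sub {w z : ℂ} {r R : ℝ} (hw : ‖w‖ ≤ r) (hz : ‖z‖ ≤ R) :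
    1 - r * R ≤ ‖1 - conj w * z‖ := by
  have h1 := norm_sub_norm_le 1 (conj w * z)
  rw [norm_one, norm_mul, RCLike.norm_conj] at h1
  have h2 := mul_le_mul hw hz (norm_nonneg z) ((norm_nonneg w).trans hw)
  linarith

lemma re_cauchyKernel_nonneg {w z : ℂ} (hw : ‖w‖ ≤ 1) (hz : ‖z‖ ≤ 1) :
    0 ≤ (1 / (1 - conj w * z)).re := by
  rw [one_div, Complex.inv_re]
  refine div_nonneg ?_ (Complex.normSq_nonneg _)
  have h1 := Complex.re_le_norm (conj w * z)
  rw [norm_mul, RCLike.norm_conj] at h1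
  have h2 := mul_le_one₀ hw (norm_nonneg z) hz
  simp only [Complex.sub_re, Complex.one_re]
  linarith

variable {ν : Measure ℂ} [IsFiniteMeasure ν] {r : ℝ} (hr : r < 1) (hν : ∀ᵐ w ∂ν, ‖w‖ ≤ r)

include hν

lemma integrable_cauchyKernel {z : ℂ} {R : ℝ} (hrR : r * R < 1) (hz : ‖z‖ ≤ R) :
    Integrable (fun w => 1 / (1 - conj w * z)) ν := by
  refine Integrable.of_bound (C := 1 / (1 - r * R)) (Measurable.aestronglyMeasurable (by fun_prop)) ?_
  filter_upwards [hν] with w hw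
  rw [norm_div, norm_one]
  exact one_div_le_one_div_of_le (by linarith) (one_sub_mul_le_norm_one_sub hw hz)

include hr

lemma diffContOnCl_cauchyTransform (hr0 : 0 ≤ r) :
    DiffContOnCl ℂ (cauchyTransform ν) (Metric.ball 0 1) := by
  set R : ℝ := 2 / (1 + r)
  have hR : 1 < R := by rw [lt_div_iff₀ (by linarith)]; linarith
  have hrR : r * R < 1 := by
    rw [mul_div_assoc', div_lt_one (by linarith)]; linarith
  have hd : DifferentiableOn ℂ (cauchyTransform ν) (Metric.ball 0 R) := by
    intro z hz
    refine DifferentiableAt.differentiableWithinAt ?_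
    refine (hasDerivAt_integral_of_dominated_loc_of_deriv_le
      (F := fun z w => 1 / (1 - conj w * z)) (F' := fun z w => conj w / (1 - conj w * z) ^ 2)
      (bound := fun _ => 1 / (1 - r * R) ^ 2) (Metric.isOpen_ball.mem_nhds hz)
      (Eventually.of_forall fun z => Measurable.aestronglyMeasurable (by fun_prop))
      (integrable_cauchyKernel hν hrR (mem_ball_zero_iff.1 hz).le)
      (Measurable.aestronglyMeasurable (by fun_prop)) ?_
      (integrable_const _) ?_).2.differentiableAt
    · filter_upwards [hν] with w hw x hx
      have h1 := one_sub_mul_le_norm_one_sub hw (mem_ball_zero_iff.1 hx).le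
      rw [norm_div, norm_pow, RCLike.norm_conj]
      have h2 : 0 < 1 - r * R := by linarith
      gcongr
      linarith
    · filter_upwards [hν] with w hw x hx
      have h1 := one_sub_mul_le_norm_one_sub hw (mem_ball_zero_iff.1 hx).le
      have h2 : 1 - conj w * x ≠ 0 := norm_pos_iff.1 (by linarith)
      have h3 : HasDerivAt (fun x => 1 - conj w * x) (-conj w) x := by
        simpa using ((hasDerivAt_id x).const_mul (conj w)).const_sub 1
      simpa [one_div] using h3.fun_inv h2
  refine DifferentiableOn.diffContOnCl (hd.mono ?_)
  rw [closure_ball _ one_ne_zero]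
  exact Metric.closedBall_subset_ball hR

lemma cauchyTransform_re {z : ℂ} (hz : ‖z‖ ≤ 1) :
    (cauchyTransform ν z).re = ∫ w, (1 / (1 - conj w * z)).re ∂ν :=
  (integral_re (𝕜 := ℂ) (integrable_cauchyKernel hν (R := 1) (by linarith) hz)).symm

lemma cauchyTransform_re_nonneg {z : ℂ} (hz : ‖z‖ ≤ 1) : 0 ≤ (cauchyTransform ν z).re := by
  rw [cauchyTransform_re hr hν hz]
  refine integral_nonneg_of_ae ?_
  filter_upwards [hν] with w hw
  exact re_cauchyKernel_nonneg (hw.trans hr.le) hz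

lemma cauchyPotential_eq_ofReal {z : ℂ} (hz : ‖z‖ ≤ 1) :
    cauchyPotential ν z = ENNReal.ofReal (cauchyTransform ν z).re := by
  rw [cauchyTransform_re hr hν hz, cauchyPotential]
  refine (ofReal_integral_eq_lintegral_ofReal
    (integrable_cauchyKernel hν (R := 1) (by linarith) hz).re ?_).symm
  filter_upwards [hν] with w hw
  exact re_cauchyKernel_nonneg (hw.trans hr.le) hz

end CauchyTransform

lemma exists_radii (μ : Measure ℂ) [IsFiniteMeasure μ] (hsupp : μ unitDiscᶜ = 0)
    {c : ℕ → ℝ} (hc : ∀ n, 0 < c n) :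
    ∃ ρ : ℕ → ℝ, StrictMono ρ ∧ ρ 0 = 0 ∧ (∀ n, ρ n < 1) ∧ Tendsto ρ atTop (𝓝 1) ∧
      ∀ n, 1 ≤ n → μ {w | ρ n ≤ ‖w‖} ≤ ENNReal.ofReal (c n) := by
  set t : ℕ → ℝ := fun k => 1 - 1 / ((k : ℝ) + 1) with ht
  have htm : StrictMono t := fun a b hab => by
    have : (a : ℝ) < b := by exact_mod_cast hab
    simp only [ht]
    gcongr
  have ht1 : ∀ k, t k < 1 := fun k => by
    have : 0 < 1 / ((k : ℝ) + 1) := by positivity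
    simp only [ht]
    linarith
  have htl : Tendsto t atTop (𝓝 1) := by
    simpa [ht] using tendsto_one_div_add_atTop_nhds_zero_nat (𝕜 := ℝ) |>.const_sub 1
  have hlim : Tendsto (fun k => μ {w | t k ≤ ‖w‖}) atTop (𝓝 0) := by
    have h1 : ⋂ k, {w : ℂ | t k ≤ ‖w‖} ⊆ unitDiscᶜ := fun w hw => by
      simp only [mem_iInter, mem_ofPred_eq] at hw
      simpa [unitDisc] using le_of_tendsto' htl hw
    rw [← measure_mono_null h1 hsupp]
    exact tendsto_measure_iInter_atTop
      (fun k => (measurableSet_le measurable_const measurable_norm).nullMeasurableSet)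
      (fun a b hab w hw => (htm.monotone hab).trans hw) ⟨0, measure_ne_top _ _⟩
  obtain ⟨φ, hφ, h⟩ := extraction_forall_of_eventually fun n =>
    ((hlim.eventually_le_const (ENNReal.ofReal_pos.2 (hc n))).and (eventually_gt_atTop 0))
  have hpos : ∀ n, 0 < t (φ n) := fun n => by
    simpa [ht] using htm (h n).2
  refine ⟨fun n => if n = 0 then 0 else t (φ n), strictMono_nat_of_lt_succ fun n => ?_, by simp,
    fun n => ?_, ?_, fun n hn => ?_⟩
  · rcases eq_or_ne n 0 with rfl | hn
    · simpa using hpos 1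
    · simpa [hn] using htm (hφ n.lt_succ_self)
  · beta_reduce
    split_ifs
    exacts [zero_lt_one, ht1 _]
  · refine (htl.comp hφ.tendsto_atTop).congr' ?_
    filter_upwards [eventually_ne_atTop 0] with n hn
    simp [hn]
  · simpa [Nat.one_le_iff_ne_zero.1 hn] using (h n).1

section Assembly

open scoped ENNReal NNReal

/-- The annulus with radii `ρ n` and `ρ (n + 1)`. -/
def annulus (ρ : ℕ → ℝ) (n : ℕ) : Set ℂ := {w | ρ n ≤ ‖w‖ ∧ ‖w‖ < ρ (n + 1)}

lemma measurableSet_annulus (ρ : ℕ → ℝ) (n : ℕ) : MeasurableSet (annulus ρ n) :=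
  (measurableSet_le measurable_const measurable_norm).inter
    (measurableSet_lt measurable_norm measurable_const)

/-- The part of `μ` on the `n`-th annulus, with mass multiplied by `n + 1`. -/
def annularMeasure (μ : Measure ℂ) (ρ : ℕ → ℝ) (n : ℕ) : Measure ℂ :=
  ((n : ℝ≥0) + 1) • μ.restrict (annulus ρ n)

instance (μ : Measure ℂ) [IsFiniteMeasure μ] (ρ : ℕ → ℝ) (n : ℕ) :
    IsFiniteMeasure (annularMeasure μ ρ n) := by
  unfold annularMeasure; infer_instance

lemma annularMeasure_real_univ_le {μ : Measure ℂ} {ρ : ℕ → ℝ} {n : ℕ} {c : ℝ} (hc : 0 ≤ c)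
    (h : μ {w | ρ n ≤ ‖w‖} ≤ ENNReal.ofReal (c / (n + 1))) :
    (annularMeasure μ ρ n).real univ ≤ c := by
  have h1 : μ.real (annulus ρ n) ≤ c / (n + 1) :=
    ENNReal.toReal_le_of_le_ofReal (by positivity) ((measure_mono fun w hw => hw.1).trans h)
  have h2 : (annularMeasure μ ρ n).real univ = ((n : ℝ) + 1) * μ.real (annulus ρ n) := by
    simp [annularMeasure, measureReal_nnreal_smul_apply]
  rw [h2]
  rwa [le_div_iff₀' (by positivity)] at h1

lemma ae_annularMeasure_norm_le (μ : Measure ℂ) (ρ : ℕ → ℝ) (n : ℕ) :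
    ∀ᵐ w ∂(annularMeasure μ ρ n), ‖w‖ ≤ ρ (n + 1) := by
  refine Measure.ae_smul_measure ?_ _
  filter_upwards [ae_restrict_mem (measurableSet_annulus ρ n)] with w hw
  exact hw.2.le

lemma smul_restrict_le_sum_annularMeasure (μ : Measure ℂ) {ρ : ℕ → ℝ}
    (hlim : Tendsto ρ atTop (𝓝 1)) (N : ℕ) :
    ((N : ℝ≥0) + 1) • μ.restrict {w | ρ N ≤ ‖w‖ ∧ ‖w‖ < 1} ≤
      Measure.sum (annularMeasure μ ρ) := by
  have hcover : {w : ℂ | ρ N ≤ ‖w‖ ∧ ‖w‖ < 1} ⊆ ⋃ n, annulus ρ (n + N) := by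
    rintro w ⟨hw1, hw2⟩
    have hex : ∃ k, ‖w‖ < ρ (k + N) :=
      ((((tendsto_add_atTop_iff_nat N).2 hlim).eventually_const_lt hw2)).exists
    classical
    have h0 : Nat.find hex ≠ 0 := fun h => by
      have := Nat.find_spec hex
      rw [h, zero_add] at this
      linarith
    obtain ⟨k, hk⟩ := Nat.exists_eq_succ_of_ne_zero h0
    refine mem_iUnion.2 ⟨k, not_lt.1 (Nat.find_min hex (by omega)), ?_⟩
    have := Nat.find_spec hex
    rwa [hk, Nat.succ_add] at this
  refine Measure.le_iff.2 fun s hs => ?_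
  have h1 := ((Measure.restrict_mono hcover le_rfl).trans Measure.restrict_iUnion_le :
    μ.restrict {w : ℂ | ρ N ≤ ‖w‖ ∧ ‖w‖ < 1} ≤ _) s
  rw [Measure.sum_apply _ hs] at h1 ⊢
  calc _ ≤ ((N : ℝ≥0) + 1) • ∑' n, μ.restrict (annulus ρ (n + N)) s := by
        rw [Measure.smul_apply]; gcongr
    _ = ∑' n, ((N : ℝ≥0) + 1) • μ.restrict (annulus ρ (n + N)) s := by
        simp only [ENNReal.smul_def, smul_eq_mul, ENNReal.tsum_mul_left]
    _ ≤ ∑' n, annularMeasure μ ρ (n + N) s := by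
        refine ENNReal.tsum_le_tsum fun n => ?_
        simp only [annularMeasure, Measure.smul_apply, ENNReal.smul_def, smul_eq_mul]
        gcongr
        simp
    _ ≤ _ := ENNReal.tsum_comp_le_tsum_of_injective (add_left_injective N) _

/-- A density dominated by `(1 + S)⁻²`, with `S` the potential of the weighted measure, gives
small mass to small Carleson squares. -/
lemma absDensity_carlesonSquare_le (μ : Measure ℂ) [IsFiniteMeasure μ] {ρ : ℕ → ℝ}
    (hlim : Tendsto ρ atTop (𝓝 1)) {E : ℂ → ℂ}
    (hE : ∀ z, ‖z‖ < 1 → ENNReal.ofReal ‖E z‖ ≤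
      ((1 + cauchyPotential (Measure.sum (annularMeasure μ ρ)) z) ^ 2)⁻¹)
    {N : ℕ} {θ₀ t : ℝ} (ht : 0 < t) (htN : t ≤ 1 - ρ N) :
    absDensity E μ (carlesonSquare θ₀ t) ≤ ENNReal.ofReal (640 / (N + 1) * t) := by
  set σ := Measure.sum (annularMeasure μ ρ)
  set g : ℂ → ℝ≥0∞ := fun z => ((1 + cauchyPotential σ z) ^ 2)⁻¹
  have hgm : Measurable g := (((measurable_cauchyPotential σ).const_add 1).pow_const 2).inv
  have hQ : carlesonSquare θ₀ t ⊆ {w | ρ N ≤ ‖w‖ ∧ ‖w‖ < 1} := fun w hw =>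
    ⟨by linarith [hw.2.1], hw.1⟩
  have h1 : ((N : ℝ≥0) + 1) • μ.restrict (carlesonSquare θ₀ t) ≤
      σ.restrict (carlesonSquare θ₀ t) := by
    rw [← Measure.restrict_restrict_of_subset hQ, ← Measure.restrict_smul]
    exact Measure.restrict_mono subset_rfl (smul_restrict_le_sum_annularMeasure μ hlim N)
  have h2 : ((N : ℝ≥0∞) + 1) * ∫⁻ z in carlesonSquare θ₀ t, g z ∂μ ≤
      ENNReal.ofReal (640 * t) := by
    refine le_trans (le_of_eq ?_) ((lintegral_mono' h1 le_rfl).trans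
      (setLIntegral_cauchyPotential_carlesonSquare_le σ θ₀ ht))
    rw [lintegral_smul_measure, ENNReal.smul_def]
    simp [g]
  rw [absDensity, withDensity_apply']
  refine (setLIntegral_mono hgm fun z hz => hE z hz.1).trans ?_
  rw [mul_comm, ← ENNReal.le_div_iff_mul_le (by simp) (by simp)] at h2
  refine h2.trans_eq ?_
  rw [div_mul_eq_mul_div, ENNReal.ofReal_div_of_pos (by positivity), ENNReal.ofReal_add
    (by positivity) zero_le_one]
  simp

end Assembly

/-- Theorem 1(b): for any finite positive Borel measure `μ` on the unit disc there is
an outer function `E ∈ QA` with `log|E| ∈ BMO` such that `|E|μ` is a vanishing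
Carleson measure. -/
theorem stmt_1 (μ : Measure ℂ) [IsFiniteMeasure μ] (hsupp : μ unitDiscᶜ = 0) :
    ∃ (E : ℂ → ℂ) (Eb : ℝ → ℂ), IsOuter E ∧ MemQA E Eb ∧
      IsBMO (fun θ => ((Real.log ‖Eb θ‖ : ℝ) : ℂ)) ∧
      IsVanishingCarleson (absDensity E μ) := by
  have hc : ∀ n : ℕ, 0 < scale n * (1 / 2) ^ n := fun n => mul_pos (scale_pos n) (by positivity)
  obtain ⟨ρ, hρ, hρ0, hρ1, hlim, hmass⟩ := exists_radii μ hsupp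
    (c := fun n => scale n * (1 / 2) ^ n / (n + 1)) fun n => div_pos (hc n) (by positivity)
  have hae := ae_annularMeasure_norm_le μ ρ
  have hpos : ∀ n, 0 ≤ ρ n := fun n => hρ0 ▸ hρ.monotone n.zero_le
  obtain ⟨E, Eb, hout, hQA, hBMO, hle⟩ := exists_outer_le_inv_sq
    (f := fun n => cauchyTransform (annularMeasure μ ρ n))
    (fun n => diffContOnCl_cauchyTransform (hρ1 _) (hae n) (hpos _))
    (fun n z hz => cauchyTransform_re_nonneg (hρ1 _) (hae n) (mem_closedBall_zero_iff.1 hz))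
    (fun n => by simp [cauchyTransform_zero])
    (fun n hn => by
      rw [cauchyTransform_zero, Complex.ofReal_re]
      exact annularMeasure_real_univ_le (hc n).le (hmass n hn))
  have hE : ∀ z, ‖z‖ < 1 → ENNReal.ofReal ‖E z‖ ≤
      ((1 + cauchyPotential (Measure.sum (annularMeasure μ ρ)) z) ^ 2)⁻¹ := by
    intro z hz
    have hsum : cauchyPotential (Measure.sum (annularMeasure μ ρ)) z =
        ∑' n, cauchyPotential (annularMeasure μ ρ n) z := lintegral_sum_measure _ _
    rw [hsum]
    refine ge_of_tendsto' (((ENNReal.continuous_pow 2).tendsto _).comp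
      ((ENNReal.tendsto_nat_tsum _).const_add 1)).inv fun N => ?_
    have hn : ∀ n, 0 ≤ (cauchyTransform (annularMeasure μ ρ n) z).re := fun n =>
      cauchyTransform_re_nonneg (hρ1 _) (hae n) hz.le
    have hs := Finset.sum_nonneg fun n (_ : n ∈ Finset.range N) => hn n
    refine (ENNReal.ofReal_le_ofReal (hle z hz N)).trans_eq ?_
    simp only [Function.comp_apply]
    rw [ENNReal.ofReal_inv_of_pos (by positivity), ENNReal.ofReal_pow (by positivity),
      ENNReal.ofReal_add zero_le_one hs, ENNReal.ofReal_sum_of_nonneg fun n _ => hn n,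
      ENNReal.ofReal_one]
    simp_rw [fun n => cauchyPotential_eq_ofReal (hρ1 _) (hae n) hz.le]
  refine ⟨E, Eb, hout, hQA, hBMO, ⟨640, by norm_num, fun θ₀ t ht ht1 => ?_⟩, fun ε hε => ?_⟩
  · simpa using absDensity_carlesonSquare_le μ hlim hE (N := 0) (θ₀ := θ₀) ht
      (by simpa [hρ0] using ht1)
  · obtain ⟨N, hN⟩ := exists_nat_gt (640 / ε)
    refine ⟨1 - ρ N, by linarith [hρ1 N], fun θ₀ t ht htN => ?_⟩
    refine (absDensity_carlesonSquare_le μ hlim hE ht htN.le).trans ?_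
    gcongr
    rw [div_lt_iff₀ hε] at hN
    rw [div_le_iff₀ (by positivity)]
    nlinarith

end
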